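/- For every integer d ≥ 3 there exists α₀ > 0 such that for every α > α₀ and every δ > 0 the following holds for the two-particle vertex-reinforced interacting random walk on the complete graph with d vertices: almost surely there exists N such that for all n ≥ N one has ∑_{i=1}^d x_i(n) y_i(n) < 2 d^{1/(α+1)} δ, i.e. the occupation-measure process z(n) eventually remains in the set S^δ = {(u,v) ∈ D : ∑_{i=1}^d u_i v_i < 2 d^{1/(α+1)} δ}. -/

import Mathlib

open MeasureTheory Filter Finset

/-- `π_i(x) = f_δ(x_i)^{−α} / ∑_k f_δ(x_k)^{−α}` with `f_δ(x) = max(δ, x)`. -/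
noncomputable def piv (d : ℕ) (δ α : ℝ) (x : Fin d → ℝ) (i : Fin d) : ℝ :=
  (max δ (x i)) ^ (-α) / ∑ k, (max δ (x k)) ^ (-α)

/-- The empirical occupation measure: `occ d X n ω i = (1 + #{1 ≤ k ≤ n : X_k(ω) = i})/(n+d)`. -/
noncomputable def occ {Ω : Type} (d : ℕ) (X : ℕ → Ω → Fin d) (n : ℕ) (ω : Ω) (i : Fin d) : ℝ :=
  (1 + ((Finset.Icc 1 n).filter (fun k => X k ω = i)).card) / (n + d)

section Drift

variable {d : ℕ} {δ α : ℝ}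

lemma pivWeight_pos (hδ : 0 < δ) (s : ℝ) : 0 < (max δ s) ^ (-α) :=
  Real.rpow_pos_of_pos (lt_max_of_lt_left hδ) _

lemma pivWeight_sum_pos (hd : 0 < d) (hδ : 0 < δ) (v : Fin d → ℝ) :
    0 < ∑ k, (max δ (v k)) ^ (-α) :=
  Finset.sum_pos (fun _ _ => pivWeight_pos hδ _) ⟨⟨0, hd⟩, Finset.mem_univ _⟩

lemma piv_nonneg (hδ : 0 < δ) (v : Fin d → ℝ) (i : Fin d) : 0 ≤ piv d δ α v i :=
  div_nonneg (pivWeight_pos hδ _).le (Finset.sum_nonneg fun _ _ => (pivWeight_pos hδ _).le)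

lemma sum_piv (hd : 0 < d) (hδ : 0 < δ) (v : Fin d → ℝ) : ∑ i, piv d δ α v i = 1 := by
  unfold piv
  rw [← Finset.sum_div, div_self (pivWeight_sum_pos hd hδ v).ne']

/-- The mean of `v` under the law `piv d δ α v`. -/
noncomputable def pivMean (d : ℕ) (δ α : ℝ) (v : Fin d → ℝ) : ℝ := ∑ i, piv d δ α v i * v i

lemma pivMean_mul_sum (hd : 0 < d) (hδ : 0 < δ) (v : Fin d → ℝ) :
    pivMean d δ α v * ∑ k, (max δ (v k)) ^ (-α) = ∑ i, (max δ (v i)) ^ (-α) * v i := by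
  have hS := pivWeight_sum_pos (α := α) hd hδ v
  unfold pivMean piv
  rw [Finset.sum_mul]
  refine Finset.sum_congr rfl fun i _ => ?_
  field_simp

/-- Bernoulli's inequality in the form used for both bounds on `pivMean`. -/
lemma rpow_neg_mul_le (hα : 1 ≤ α) {a s : ℝ} (ha : 0 < a) (has : a ≤ s) :
    s ^ (-α) * (a + α * (s - a)) ≤ a * a ^ (-α) := by
  have hs : 0 < s := ha.trans_le has
  have h := one_add_mul_self_le_rpow_one_add (s := s / a - 1)
    (by have := div_pos hs ha; linarith) hα
  rw [add_sub_cancel, Real.div_rpow hs.le ha.le] at h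
  have hsα := Real.rpow_pos_of_pos hs α
  have haα := Real.rpow_pos_of_pos ha α
  rw [Real.rpow_neg hs.le, Real.rpow_neg ha.le]
  have h2 : (a + α * (s - a)) * a ^ α ≤ a * s ^ α := by
    have h3 : (1 + α * (s / a - 1)) * (a * a ^ α) ≤ s ^ α / a ^ α * (a * a ^ α) :=
      mul_le_mul_of_nonneg_right h (by positivity)
    have e1 : (1 + α * (s / a - 1)) * (a * a ^ α) = (a + α * (s - a)) * a ^ α := by
      field_simp
    have e2 : s ^ α / a ^ α * (a * a ^ α) = a * s ^ α := by field_simp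
    linarith
  rw [inv_mul_eq_div, ← div_eq_mul_inv, div_le_div_iff₀ hsα haα]
  exact h2

lemma pivMean_le (hd : 0 < d) (hδ : 0 < δ) (hα : 1 ≤ α) (v : Fin d → ℝ) (k : Fin d)
    (hk : ∀ i, v k ≤ v i) : pivMean d δ α v ≤ (1 + d / α) * max δ (v k) := by
  have hS := pivWeight_sum_pos (α := α) hd hδ v
  set a := max δ (v k) with ha
  have ha0 : 0 < a := lt_max_of_lt_left hδ
  have hα0 : 0 < α := by linarith
  have hi : ∀ i, (max δ (v i)) ^ (-α) * v i ≤ a * (max δ (v i)) ^ (-α) + a / α * a ^ (-α) := by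
    intro i
    have h1 := rpow_neg_mul_le hα ha0 (max_le_max_left δ (hk i))
    have h2 := pivWeight_pos (α := α) hδ (v i)
    have h3 := mul_le_mul_of_nonneg_left (le_max_right δ (v i)) h2.le
    have h4 : (max δ (v i)) ^ (-α) * (max δ (v i) - a) ≤ a / α * a ^ (-α) := by
      rw [div_mul_eq_mul_div, le_div_iff₀ hα0]
      have := mul_pos h2 ha0
      linarith
    linarith
  have hak : a ^ (-α) ≤ ∑ i, (max δ (v i)) ^ (-α) :=
    Finset.single_le_sum (f := fun i => (max δ (v i)) ^ (-α))
      (fun i _ => (pivWeight_pos hδ (v i)).le) (Finset.mem_univ k)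
  have hsum := Finset.sum_le_sum fun i (_ : i ∈ Finset.univ) => hi i
  rw [← pivMean_mul_sum hd hδ, Finset.sum_add_distrib, ← Finset.mul_sum, Finset.sum_const,
    Finset.card_univ, Fintype.card_fin, nsmul_eq_mul] at hsum
  have h5 : (d : ℝ) * (a / α * a ^ (-α)) ≤ d * (a / α) * ∑ i, (max δ (v i)) ^ (-α) := by
    rw [← mul_assoc]
    exact mul_le_mul_of_nonneg_left hak (by positivity)
  refine le_of_mul_le_mul_right (hsum.trans ?_) hS
  have e : (1 + d / α) * a * ∑ i, (max δ (v i)) ^ (-α)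
      = a * ∑ i, (max δ (v i)) ^ (-α) + d * (a / α) * ∑ i, (max δ (v i)) ^ (-α) := by ring
  linarith

/-- Chebyshev's association inequality for `pivMean`, with a quantitative gap. -/
lemma two_mul_sum_sq_le (hd : 0 < d) (hδ : 0 < δ) (hα : 8 * (d : ℝ) ≤ α) (v : Fin d → ℝ)
    (hv : ∑ i, v i = 1) (k : Fin d) (hk : ∀ i, v k ≤ v i) (hvδ : δ ≤ v k)
    (hsmall : ∀ i, v i - v k ≤ 1 / (8 * (d : ℝ) ^ 2)) :
    2 * ∑ i, (v i - 1 / d) ^ 2 ≤ 1 / d - pivMean d δ α v := by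
  have hd' : (1 : ℝ) ≤ d := by exact_mod_cast hd
  have hd0 : (0 : ℝ) < d := by linarith
  have hα1 : 1 ≤ α := by linarith
  have hS := pivWeight_sum_pos (α := α) hd hδ v
  set a := v k with ha
  have ha0 : 0 < a := hδ.trans_le hvδ
  have hmax : ∀ i, max δ (v i) = v i := fun i => max_eq_right (hvδ.trans (hk i))
  have hm := pivMean_mul_sum (α := α) hd hδ v
  simp only [hmax] at hm hS
  set g : Fin d → ℝ := fun i => v i ^ (-α) with hg
  have hgk : ∀ i, g i ≤ g k := fun i =>
    Real.rpow_le_rpow_of_nonpos ha0 (hk i) (by linarith)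
  have hanti : ∀ i j, 0 ≤ (v i - v j) * (g j - g i) := by
    intro i j
    rcases le_total (v i) (v j) with h | h
    · have : g j ≤ g i := Real.rpow_le_rpow_of_nonpos (ha0.trans_le (hk i)) h (by linarith)
      exact mul_nonneg_of_nonpos_of_nonpos (by linarith) (by linarith)
    · have : g i ≤ g j := Real.rpow_le_rpow_of_nonpos (ha0.trans_le (hk j)) h (by linarith)
      exact mul_nonneg (by linarith) (by linarith)
  have hdouble : ∑ i, ∑ j, (v i - v j) * (g j - g i)
      = 2 * ((∑ i, g i) - d * ∑ i, g i * v i) := by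
    have e1 : ∀ i j, (v i - v j) * (g j - g i) = v i * g j - g i * v i - g j * v j + g i * v j := by
      intro i j; ring
    simp only [e1, Finset.sum_add_distrib, Finset.sum_sub_distrib, ← Finset.mul_sum,
      ← Finset.sum_mul, Finset.sum_const, Finset.card_univ, Fintype.card_fin, nsmul_eq_mul, hv]
    simp only [mul_left_comm _ (d : ℝ), ← Finset.mul_sum]
    ring
  have hlow : ∑ i, (v i - a) * (g k - g i) ≤ ∑ i, ∑ j, (v i - v j) * (g j - g i) :=
    Finset.sum_le_sum fun i _ => Finset.single_le_sum (f := fun j => (v i - v j) * (g j - g i))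
      (fun j _ => hanti i j) (Finset.mem_univ k)
  have had : d * a ≤ 1 := by
    rw [← hv]
    have := Finset.sum_le_sum fun i (_ : i ∈ Finset.univ) => hk i
    simpa using this
  have hterm : ∀ i, 4 * d ^ 2 * g k * (v i - a) ^ 2 ≤ (v i - a) * (g k - g i) := by
    intro i
    have ht : 0 ≤ v i - a := sub_nonneg.2 (hk i)
    set t := v i - a with htdef
    have hgk0 : 0 < g k := Real.rpow_pos_of_pos ha0 _
    have hb : g i * (a + α * t) ≤ a * g k := rpow_neg_mul_le hα1 ha0 (hk i)
    have hden : 0 < a + α * t := by positivity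
    have h1 : g k * (α * t) ≤ (g k - g i) * (a + α * t) := by linarith
    have hden2 : 4 * d ^ 2 * (a + α * t) ≤ α := by
      have e1 : 4 * (d : ℝ) ^ 2 * a ≤ 4 * d := by
        have := mul_le_mul_of_nonneg_left had (by positivity : (0 : ℝ) ≤ 4 * d)
        linarith
      have e2 : 4 * (d : ℝ) ^ 2 * t ≤ 1 / 2 := by
        have := mul_le_mul_of_nonneg_left (hsmall i) (by positivity : (0 : ℝ) ≤ 4 * d ^ 2)
        have e3 : 4 * (d : ℝ) ^ 2 * (1 / (8 * d ^ 2)) = 1 / 2 := by field_simp; norm_num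
        linarith
      have e4 := mul_le_mul_of_nonneg_right e2 (by linarith : (0 : ℝ) ≤ α)
      linarith
    have h2 : 4 * d ^ 2 * g k * t ≤ g k - g i := by
      refine le_of_mul_le_mul_right ?_ hden
      have := mul_le_mul_of_nonneg_left hden2 (mul_nonneg hgk0.le ht)
      linarith
    have := mul_le_mul_of_nonneg_left h2 ht
    linarith
  have hsum := Finset.sum_le_sum fun i (_ : i ∈ Finset.univ) => hterm i
  rw [← Finset.mul_sum] at hsum
  have hSg : ∑ i, g i ≤ d * g k := by
    have := Finset.sum_le_sum fun i (_ : i ∈ Finset.univ) => hgk i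
    simpa using this
  have hvar : ∑ i, (v i - 1 / d) ^ 2 ≤ ∑ i, (v i - a) ^ 2 := by
    have e : ∀ c : ℝ, ∑ i, (v i - c) ^ 2 = (∑ i, v i ^ 2) - 2 * c + d * c ^ 2 := by
      intro c
      have : ∀ i, (v i - c) ^ 2 = v i ^ 2 - 2 * c * v i + c ^ 2 := fun i => by ring
      simp only [this, Finset.sum_add_distrib, Finset.sum_sub_distrib, ← Finset.mul_sum, hv,
        Finset.sum_const, Finset.card_univ, Fintype.card_fin, nsmul_eq_mul]
      ring
    rw [e, e]
    have e2 : (d : ℝ) * (1 / d) ^ 2 = 1 / d := by field_simp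
    have e3 : (d : ℝ) * (a - 1 / d) ^ 2 = d * a ^ 2 - 2 * a + 1 / d := by field_simp; ring
    have : 0 ≤ (d : ℝ) * (a - 1 / d) ^ 2 := by positivity
    linarith
  have hq : 0 ≤ ∑ i, (v i - a) ^ 2 := Finset.sum_nonneg fun _ _ => sq_nonneg _
  refine (mul_le_mul_of_nonneg_left hvar zero_le_two).trans ?_
  refine le_of_mul_le_mul_right ?_ (mul_pos hd0 hS)
  have h1 : 2 * (d : ℝ) * (∑ i, (v i - a) ^ 2) * (∑ i, g i)
      ≤ 2 * (d : ℝ) * (∑ i, (v i - a) ^ 2) * (d * g k) :=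
    mul_le_mul_of_nonneg_left hSg (by positivity)
  have h2 : (1 / (d : ℝ) - pivMean d δ α v) * (d * ∑ i, v i ^ (-α))
      = (∑ i, g i) - d * ∑ i, g i * v i := by
    rw [← hm]; field_simp
    ring
  rw [h2]
  linarith

lemma le_overlap {u v : Fin d → ℝ} (hu : ∑ i, u i = 1) (hv : ∑ i, v i = 1) (a b : ℝ)
    (hb : ∀ i, b ≤ u i) (ha : ∀ i, a ≤ v i) : a + b - d * a * b ≤ ∑ i, u i * v i := by
  have h : 0 ≤ ∑ i, (u i - b) * (v i - a) :=
    Finset.sum_nonneg fun i _ => mul_nonneg (sub_nonneg.2 (hb i)) (sub_nonneg.2 (ha i))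
  have e : ∀ i, (u i - b) * (v i - a) = u i * v i - a * u i - b * v i + a * b := fun i => by ring
  simp only [e, Finset.sum_add_distrib, Finset.sum_sub_distrib, ← Finset.mul_sum, hu, hv,
    Finset.sum_const, Finset.card_univ, Fintype.card_fin, nsmul_eq_mul] at h
  linarith

/-- Squared distance of `(u, v)` from the uniform pair. -/
noncomputable def unifDist (d : ℕ) (u v : Fin d → ℝ) : ℝ :=
  ∑ i, (u i - 1 / d) ^ 2 + ∑ i, (v i - 1 / d) ^ 2

lemma unifDist_nonneg (u v : Fin d → ℝ) : 0 ≤ unifDist d u v :=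
  add_nonneg (Finset.sum_nonneg fun _ _ => sq_nonneg _) (Finset.sum_nonneg fun _ _ => sq_nonneg _)

/-- The decay rate of the overlap `∑ u_i v_i` along the mean-field flow. -/
noncomputable def decay (d : ℕ) (δ α : ℝ) (u v : Fin d → ℝ) : ℝ :=
  2 * ∑ i, u i * v i - pivMean d δ α u - pivMean d δ α v

lemma overlap_sub (hd : 0 < d) {u v : Fin d → ℝ} (hu : ∑ i, u i = 1) (hv : ∑ i, v i = 1) :
    ∑ i, (u i - 1 / d) * (v i - 1 / d) = (∑ i, u i * v i) - 1 / d := by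
  have hd0 : (d : ℝ) ≠ 0 := by positivity
  have e : ∀ i, (u i - 1 / (d : ℝ)) * (v i - 1 / d)
      = u i * v i - 1 / d * u i - 1 / d * v i + 1 / d * (1 / d) := fun i => by ring
  simp only [e, Finset.sum_add_distrib, Finset.sum_sub_distrib, ← Finset.mul_sum, hu, hv,
    Finset.sum_const, Finset.card_univ, Fintype.card_fin, nsmul_eq_mul]
  field_simp
  ring

lemma abs_overlap_sub_le (hd : 0 < d) {u v : Fin d → ℝ} (hu : ∑ i, u i = 1)
    (hv : ∑ i, v i = 1) :
    |(∑ i, u i * v i) - 1 / d| ≤ unifDist d u v / 2 := by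
  rw [← overlap_sub hd hu hv]
  unfold unifDist
  have h1 : 0 ≤ ∑ i, ((u i - 1 / d) + (v i - 1 / d)) ^ 2 :=
    Finset.sum_nonneg fun _ _ => sq_nonneg _
  have h2 : 0 ≤ ∑ i, ((u i - 1 / d) - (v i - 1 / d)) ^ 2 :=
    Finset.sum_nonneg fun _ _ => sq_nonneg _
  simp only [add_sq, sub_sq (_ - _), Finset.sum_add_distrib, Finset.sum_sub_distrib, mul_assoc,
    ← Finset.mul_sum] at h1 h2
  rw [abs_le]
  constructor <;> linarith

lemma unifDist_le_decay_or_decay_pos (hd : 0 < d) (hδ : 0 < δ) (hα : 16 * (d : ℝ) ^ 3 < α)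
    {u v : Fin d → ℝ} (hu : u ∈ stdSimplex ℝ (Fin d)) (hv : v ∈ stdSimplex ℝ (Fin d))
    (huv : 3 / 2 * δ ≤ ∑ i, u i * v i) :
    unifDist d u v ≤ decay d δ α u v ∨ 0 < decay d δ α u v := by
  have hd' : (1 : ℝ) ≤ d := by exact_mod_cast hd
  have hd0 : (0 : ℝ) < d := by linarith
  have hd3 : (d : ℝ) ≤ d ^ 3 := le_self_pow₀ hd' (by norm_num)
  have hα1 : 1 ≤ α := by linarith
  have hα0 : 0 < α := by linarith
  have hα8 : 8 * (d : ℝ) ≤ α := by linarith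
  have : Nonempty (Fin d) := ⟨⟨0, hd⟩⟩
  obtain ⟨k, hk⟩ := Finite.exists_min v
  obtain ⟨l, hl⟩ := Finite.exists_min u
  have hmv := pivMean_le hd hδ hα1 v k hk
  have hmu := pivMean_le hd hδ hα1 u l hl
  have hover := le_overlap hu.2 hv.2 (v k) (u l) hl hk
  have hdec := abs_overlap_sub_le hd hu.2 hv.2
  have hcv : v k ≤ ∑ i, u i * v i := by
    calc v k = ∑ i, u i * v k := by rw [← Finset.sum_mul, hu.2, one_mul]
      _ ≤ _ := Finset.sum_le_sum fun i _ => mul_le_mul_of_nonneg_left (hk i) (hu.1 i)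
  have hcu : u l ≤ ∑ i, u i * v i := by
    calc u l = ∑ i, u l * v i := by rw [← Finset.mul_sum, hv.2, mul_one]
      _ ≤ _ := Finset.sum_le_sum fun i _ => mul_le_mul_of_nonneg_right (hl i) (hv.1 i)
  have hκ : (d : ℝ) / α < 1 / (16 * d ^ 2) := by
    rw [div_lt_div_iff₀ hα0 (by positivity)]
    have : (d : ℝ) * (16 * d ^ 2) = 16 * d ^ 3 := by ring
    linarith
  have hκ0 : 0 < (d : ℝ) / α := by positivity
  have hκ16 : (d : ℝ) / α < 1 / 16 := by
    refine hκ.trans_le ?_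
    apply one_div_le_one_div_of_le (by norm_num)
    have : (1 : ℝ) ≤ d ^ 2 := one_le_pow₀ hd'
    linarith
  set κ := (d : ℝ) / α with hκdef
  set H := ∑ i, u i * v i with hH
  by_cases hfloor : δ ≤ v k ∧ δ ≤ u l
  · obtain ⟨hvδ, huδ⟩ := hfloor
    rw [max_eq_right hvδ] at hmv
    rw [max_eq_right huδ] at hmu
    by_cases hnear : (∀ i, v i - v k ≤ 1 / (8 * (d : ℝ) ^ 2)) ∧
        (∀ i, u i - u l ≤ 1 / (8 * (d : ℝ) ^ 2))
    · left
      have h1 := two_mul_sum_sq_le hd hδ hα8 v hv.2 k hk hvδ hnear.1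
      have h2 := two_mul_sum_sq_le hd hδ hα8 u hu.2 l hl huδ hnear.2
      have h3 := (abs_le.1 hdec).1
      unfold decay
      unfold unifDist at h3 ⊢
      have h4 : 0 ≤ ∑ i, (u i - 1 / d) ^ 2 := Finset.sum_nonneg fun _ _ => sq_nonneg _
      have h5 : 0 ≤ ∑ i, (v i - 1 / d) ^ 2 := Finset.sum_nonneg fun _ _ => sq_nonneg _
      linarith
    · right
      have hbound : ∀ w : Fin d → ℝ, ∑ i, w i = 1 → ∀ m, (∀ i, w m ≤ w i) → d * w m ≤ 1 := by
        intro w hw m hm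
        rw [← hw]
        simpa using Finset.sum_le_sum fun i (_ : i ∈ Finset.univ) => hm i
      have hfar : ∀ w : Fin d → ℝ, ∑ i, w i = 1 → ∀ m, (∀ i, w m ≤ w i) →
          ¬ (∀ i, w i - w m ≤ 1 / (8 * (d : ℝ) ^ 2)) → d * w m ≤ 1 - 1 / (8 * (d : ℝ) ^ 2) := by
        intro w hw m hm hnot
        push Not at hnot
        obtain ⟨i, hi⟩ := hnot
        have h1 : w i - w m ≤ ∑ j, (w j - w m) :=
          Finset.single_le_sum (f := fun j => w j - w m) (fun j _ => sub_nonneg.2 (hm j))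
            (Finset.mem_univ i)
        simp only [Finset.sum_sub_distrib, hw, Finset.sum_const, Finset.card_univ,
          Fintype.card_fin, nsmul_eq_mul] at h1
        linarith
      set ρ := 1 / (8 * (d : ℝ) ^ 2) with hρ
      have hρ0 : 0 < ρ := by positivity
      have hκρ : κ < ρ / 2 := by
        have : ρ / 2 = 1 / (16 * (d : ℝ) ^ 2) := by rw [hρ]; field_simp; norm_num
        linarith
      have ha0 : 0 < v k := hδ.trans_le hvδ
      have hb0 : 0 < u l := hδ.trans_le huδ
      have hbil : ∀ A B : ℝ, 0 ≤ A → 0 ≤ B → A ≤ 1 - ρ → B ≤ 1 →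
          ρ / 2 * (A + B) ≤ A + B - 2 * A * B := by
        intro A B hA hB hA1 hB1
        nlinarith [mul_nonneg hA (sub_nonneg.2 hB1), mul_nonneg hB (sub_nonneg.2 hA1),
          mul_nonneg hρ0.le hA, mul_nonneg hρ0.le hB, mul_nonneg hA hB,
          mul_nonneg (sub_nonneg.2 hA1) (sub_nonneg.2 hB1),
          mul_nonneg hρ0.le (mul_nonneg hA (sub_nonneg.2 hB1)),
          mul_nonneg hρ0.le (mul_nonneg hB (sub_nonneg.2 hA1)),
          mul_nonneg hρ0.le (mul_nonneg (sub_nonneg.2 hA1) (sub_nonneg.2 hB1))]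
      have hmain : ρ / 2 * (d * v k + d * u l)
          ≤ d * v k + d * u l - 2 * (d * v k) * (d * u l) := by
        rcases not_and_or.1 hnear with h | h
        · exact hbil _ _ (by positivity) (by positivity) (hfar v hv.2 k hk h)
            (hbound u hu.2 l hl)
        · have := hbil (d * u l) (d * v k) (by positivity) (by positivity) (hfar u hu.2 l hl h)
            (hbound v hv.2 k hk)
          linarith
      have hmain' : ρ / 2 * (v k + u l) ≤ v k + u l - 2 * d * v k * u l := by
        refine le_of_mul_le_mul_left ?_ hd0
        linarith
      have : κ * (v k + u l) < ρ / 2 * (v k + u l) :=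
        mul_lt_mul_of_pos_right hκρ (by linarith)
      unfold decay
      linarith
  · right
    have hκv := mul_le_mul_of_nonneg_right hκ16.le (le_max_of_le_left hδ.le : 0 ≤ max δ (v k))
    have hκu := mul_le_mul_of_nonneg_right hκ16.le (le_max_of_le_left hδ.le : 0 ≤ max δ (u l))
    unfold decay
    rcases not_and_or.1 hfloor with h | h
    · rw [max_eq_left (not_le.1 h).le] at hmv hκv
      rcases max_cases δ (u l) with h' | h' <;> rw [h'.1] at hmu hκu <;> linarith
    · rw [max_eq_left (not_le.1 h).le] at hmu hκu
      rcases max_cases δ (v k) with h' | h' <;> rw [h'.1] at hmv hκv <;> linarith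

lemma decay_nonneg (hd : 0 < d) (hδ : 0 < δ) (hα : 16 * (d : ℝ) ^ 3 < α)
    {u v : Fin d → ℝ} (hu : u ∈ stdSimplex ℝ (Fin d)) (hv : v ∈ stdSimplex ℝ (Fin d))
    (huv : 3 / 2 * δ ≤ ∑ i, u i * v i) : 0 ≤ decay d δ α u v := by
  rcases unifDist_le_decay_or_decay_pos hd hδ hα hu hv huv with h | h
  · exact (unifDist_nonneg u v).trans h
  · exact h.le

lemma continuous_piv (hd : 0 < d) (hδ : 0 < δ) (i : Fin d) :
    Continuous fun v => piv d δ α v i := by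
  unfold piv
  have h : ∀ j : Fin d, Continuous fun v : Fin d → ℝ => (max δ (v j)) ^ (-α) := fun j =>
    (continuous_const.max (continuous_apply j)).rpow_const
      fun v => Or.inl (lt_max_of_lt_left hδ).ne'
  exact (h i).div (continuous_finsetSum _ fun j _ => h j)
    fun v => (pivWeight_sum_pos hd hδ v).ne'

lemma exists_le_decay (hd : 0 < d) (hδ : 0 < δ) (hα : 16 * (d : ℝ) ^ 3 < α) {r : ℝ}
    (hr : 0 < r) :
    ∃ c > 0, ∀ u ∈ stdSimplex ℝ (Fin d), ∀ v ∈ stdSimplex ℝ (Fin d),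
      3 / 2 * δ ≤ ∑ i, u i * v i → r ≤ unifDist d u v → c ≤ decay d δ α u v := by
  let K : Set ((Fin d → ℝ) × (Fin d → ℝ)) := (stdSimplex ℝ (Fin d) ×ˢ stdSimplex ℝ (Fin d)) ∩
    ({z | 3 / 2 * δ ≤ ∑ i, z.1 i * z.2 i} ∩ {z | r ≤ unifDist d z.1 z.2})
  have hcont : Continuous fun z : (Fin d → ℝ) × (Fin d → ℝ) => decay d δ α z.1 z.2 := by
    have hm : Continuous fun v : Fin d → ℝ => pivMean d δ α v :=
      continuous_finsetSum _ fun i _ => (continuous_piv hd hδ i).mul (continuous_apply i)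
    have h1 := hm.comp (continuous_fst (X := Fin d → ℝ) (Y := Fin d → ℝ))
    have h2 := hm.comp (continuous_snd (X := Fin d → ℝ) (Y := Fin d → ℝ))
    have h3 : Continuous fun z : (Fin d → ℝ) × (Fin d → ℝ) => 2 * ∑ i, z.1 i * z.2 i := by
      fun_prop
    exact (h3.sub h1).sub h2
  have hK : IsCompact K := by
    refine ((isCompact_stdSimplex ℝ (Fin d)).prod (isCompact_stdSimplex ℝ (Fin d))).inter_right
      (IsClosed.inter ?_ ?_)
    · exact isClosed_le continuous_const (by fun_prop)
    · refine isClosed_le continuous_const ?_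
      unfold unifDist
      fun_prop
  rcases K.eq_empty_or_nonempty with hE | hE
  · refine ⟨1, one_pos, fun u hu v hv h1 h2 => ?_⟩
    have : (u, v) ∈ K := ⟨⟨hu, hv⟩, h1, h2⟩
    simp [hE] at this
  · obtain ⟨z, hz, hmin⟩ := hK.exists_isMinOn hE hcont.continuousOn
    refine ⟨decay d δ α z.1 z.2, ?_, fun u hu v hv h1 h2 => ?_⟩
    · rcases unifDist_le_decay_or_decay_pos hd hδ hα hz.1.1 hz.1.2 hz.2.1 with h | h
      · exact (hr.trans_le hz.2.2).trans_le h
      · exact h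
    · exact hmin (show (u, v) ∈ K from ⟨⟨hu, hv⟩, h1, h2⟩)

end Drift

section OneStep

variable {d : ℕ} {δ α : ℝ}

/-- The occupation vector `u` after a visit to vertex `i` with step size `γ`. -/
noncomputable def move (γ : ℝ) (u : Fin d → ℝ) (i : Fin d) : Fin d → ℝ :=
  fun k => (1 - γ) * u k + γ * (if i = k then 1 else 0)

lemma overlap_move (γ : ℝ) (u v : Fin d → ℝ) (i j : Fin d) :
    ∑ k, move γ u i k * move γ v j k = (1 - γ) ^ 2 * ∑ k, u k * v k
      + γ * (1 - γ) * (v i + u j) + γ ^ 2 * (if i = j then 1 else 0) := by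
  have e : ∀ k, move γ u i k * move γ v j k = (1 - γ) ^ 2 * (u k * v k)
      + γ * (1 - γ) * (if i = k then v k else 0) + γ * (1 - γ) * (if j = k then u k else 0)
      + γ ^ 2 * (if i = k then (if j = k then 1 else 0) else 0) := by
    intro k
    unfold move
    split_ifs <;> ring
  simp only [e, Finset.sum_add_distrib, ← Finset.mul_sum, Finset.sum_ite_eq, Finset.mem_univ,
    if_true, eq_comm (a := j) (b := i)]
  ring

lemma sqDist_move (γ : ℝ) (u v : Fin d → ℝ) (i j : Fin d) :
    ∑ k, (move γ u i k - move γ v j k) ^ 2 = (1 - γ) ^ 2 * ∑ k, (u k - v k) ^ 2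
      + 2 * γ * (1 - γ) * ((u i - v i) - (u j - v j))
      + γ ^ 2 * (2 - 2 * (if i = j then 1 else 0)) := by
  have e : ∀ k, (move γ u i k - move γ v j k) ^ 2 = (1 - γ) ^ 2 * (u k - v k) ^ 2
      + 2 * γ * (1 - γ) * (if i = k then u k - v k else 0)
      - 2 * γ * (1 - γ) * (if j = k then u k - v k else 0)
      + γ ^ 2 * (if i = k then 1 else 0) + γ ^ 2 * (if j = k then 1 else 0)
      - 2 * γ ^ 2 * (if i = k then (if j = k then 1 else 0) else 0) := by
    intro k
    unfold move
    split_ifs <;> ring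
  simp only [e, Finset.sum_add_distrib, Finset.sum_sub_distrib, ← Finset.mul_sum,
    Finset.sum_ite_eq, Finset.mem_univ, if_true, eq_comm (a := j) (b := i)]
  ring

/-- Expectation of `F` under the product of the laws `p` and `q`. -/
noncomputable def pairExp (p q : Fin d → ℝ) (F : Fin d → Fin d → ℝ) : ℝ :=
  ∑ i, ∑ j, p i * q j * F i j

lemma pairExp_affine {p q : Fin d → ℝ} (hp : ∑ i, p i = 1) (hq : ∑ i, q i = 1) (A E : ℝ)
    (B C : Fin d → ℝ) :
    pairExp p q (fun i j => A + B i + C j + E * (if i = j then 1 else 0))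
      = A + ∑ i, p i * B i + ∑ j, q j * C j + E * ∑ i, p i * q i := by
  have e : ∀ i j, p i * q j * (A + B i + C j + E * (if i = j then 1 else 0))
      = A * p i * q j + p i * B i * q j + p i * (q j * C j)
        + (if i = j then E * (p i * q j) else 0) := by
    intro i j
    split_ifs <;> ring
  simp only [pairExp, e, Finset.sum_add_distrib, ← Finset.mul_sum, ← Finset.sum_mul, hp, hq,
    Finset.sum_ite_eq, Finset.mem_univ, if_true]
  ring

lemma pairExp_mono {p q : Fin d → ℝ} (hp : ∀ i, 0 ≤ p i) (hq : ∀ i, 0 ≤ q i)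
    {F G : Fin d → Fin d → ℝ} (h : ∀ i j, F i j ≤ G i j) : pairExp p q F ≤ pairExp p q G :=
  Finset.sum_le_sum fun i _ => Finset.sum_le_sum fun j _ =>
    mul_le_mul_of_nonneg_left (h i j) (mul_nonneg (hp i) (hq j))

lemma sum_mul_nonneg_le_one {p q : Fin d → ℝ} (hp : p ∈ stdSimplex ℝ (Fin d))
    (hq : q ∈ stdSimplex ℝ (Fin d)) : 0 ≤ ∑ i, p i * q i ∧ ∑ i, p i * q i ≤ 1 := by
  refine ⟨Finset.sum_nonneg fun i _ => mul_nonneg (hp.1 i) (hq.1 i), ?_⟩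
  rw [← hp.2]
  refine Finset.sum_le_sum fun i _ => mul_le_of_le_one_right (hp.1 i) ?_
  rw [← hq.2]
  exact Finset.single_le_sum (fun j _ => hq.1 j) (Finset.mem_univ i)

lemma le_one_of_mem_stdSimplex {p : Fin d → ℝ} (hp : p ∈ stdSimplex ℝ (Fin d)) (i : Fin d) :
    p i ≤ 1 := by
  rw [← hp.2]
  exact Finset.single_le_sum (fun j _ => hp.1 j) (Finset.mem_univ i)

lemma piv_mem (hd : 0 < d) (hδ : 0 < δ) (v : Fin d → ℝ) :
    (fun i => piv d δ α v i) ∈ stdSimplex ℝ (Fin d) :=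
  ⟨fun i => piv_nonneg hδ v i, sum_piv hd hδ v⟩

/-- One-step conditional expectation of a function of the pair of occupation vectors. -/
noncomputable def nextExp (d : ℕ) (δ α γ : ℝ) (V : (Fin d → ℝ) → (Fin d → ℝ) → ℝ)
    (u v : Fin d → ℝ) : ℝ :=
  pairExp (piv d δ α v) (piv d δ α u) fun i j => V (move γ u i) (move γ v j)

lemma nextExp_mono (hδ : 0 < δ) {γ : ℝ} {V V' : (Fin d → ℝ) → (Fin d → ℝ) → ℝ}
    {u v : Fin d → ℝ} (h : ∀ i j, V (move γ u i) (move γ v j) ≤ V' (move γ u i) (move γ v j)) :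
    nextExp d δ α γ V u v ≤ nextExp d δ α γ V' u v :=
  pairExp_mono (fun i => piv_nonneg hδ v i) (fun i => piv_nonneg hδ u i) h

lemma nextExp_affine_overlap (hd : 0 < d) (hδ : 0 < δ) (γ a b : ℝ) (u v : Fin d → ℝ) :
    nextExp d δ α γ (fun u v => a + b * ∑ k, u k * v k) u v = a + b * ((∑ k, u k * v k)
      - γ * (1 - γ) * decay d δ α u v
      + γ ^ 2 * ((∑ i, piv d δ α v i * piv d δ α u i) - ∑ k, u k * v k)) := by
  unfold nextExp
  have e : ∀ i j, a + b * ∑ k, move γ u i k * move γ v j k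
      = (a + b * (1 - γ) ^ 2 * ∑ k, u k * v k) + b * γ * (1 - γ) * v i + b * γ * (1 - γ) * u j
        + b * γ ^ 2 * (if i = j then 1 else 0) := by
    intro i j
    rw [overlap_move]
    ring
  simp only [e]
  rw [pairExp_affine (sum_piv hd hδ v) (sum_piv hd hδ u)]
  simp only [mul_left_comm (piv d δ α _ _), ← Finset.mul_sum]
  unfold decay pivMean
  ring

lemma decay_le_nextExp (hd : 0 < d) (hδ : 0 < δ) {u v : Fin d → ℝ}
    (hu : u ∈ stdSimplex ℝ (Fin d)) (hv : v ∈ stdSimplex ℝ (Fin d))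
    (hG : 0 ≤ decay d δ α u v) {s γ : ℝ} (hγ : 0 < γ) (hγ1 : γ ≤ 1 / 2) (hγs : γ ≤ s)
    (hsγ : s - γ = s * γ) :
    -(∑ k, u k * v k) - s + γ / 2 * decay d δ α u v
      ≤ nextExp d δ α γ (fun u v => -(∑ k, u k * v k) - γ) u v := by
  have h := nextExp_affine_overlap (α := α) hd hδ γ (-γ) (-1) u v
  have e : (fun u v : Fin d → ℝ => -(∑ k, u k * v k) - γ)
      = fun u v => -γ + -1 * ∑ k, u k * v k := by
    funext u v
    ring
  rw [e, h]
  have h1 := (sum_mul_nonneg_le_one (piv_mem (α := α) hd hδ v) (piv_mem (α := α) hd hδ u)).2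
  have h2 := (sum_mul_nonneg_le_one hu hv).1
  have h3 : γ / 2 * decay d δ α u v ≤ γ * (1 - γ) * decay d δ α u v :=
    mul_le_mul_of_nonneg_right (by nlinarith) hG
  have h4 : γ ^ 2 * ((∑ i, piv d δ α v i * piv d δ α u i) - ∑ k, u k * v k) ≤ γ ^ 2 * 1 :=
    mul_le_mul_of_nonneg_left (by linarith) (sq_nonneg γ)
  have h5 : γ * γ ≤ s * γ := mul_le_mul_of_nonneg_right hγs hγ.le
  linarith

lemma sq_max_add_le (a t : ℝ) : (max (a + t) 0) ^ 2 ≤ (max a 0) ^ 2 + 2 * max a 0 * t + t ^ 2 := by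
  rcases max_cases a 0 with h | h <;> rcases max_cases (a + t) 0 with h' | h' <;>
    rw [h.1, h'.1] <;> nlinarith [sq_nonneg (a + t), sq_nonneg t, sq_nonneg a]

lemma nextExp_excess_le (hd : 0 < d) (hδ : 0 < δ) (hα : 16 * (d : ℝ) ^ 3 < α)
    {u v : Fin d → ℝ} (hu : u ∈ stdSimplex ℝ (Fin d)) (hv : v ∈ stdSimplex ℝ (Fin d))
    {s γ : ℝ} (hγ : 0 < γ) (hγ1 : γ ≤ 1 / 2) (hγs : γ ≤ s) (hsγ : s - γ = s * γ) :
    -((max ((∑ k, u k * v k) - 3 / 2 * δ) 0) ^ 2 + 11 * s)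
      ≤ nextExp d δ α γ
          (fun u v => -((max ((∑ k, u k * v k) - 3 / 2 * δ) 0) ^ 2 + 11 * γ)) u v := by
  obtain ⟨hH0, hH1⟩ := sum_mul_nonneg_le_one hu hv
  set H := ∑ k, u k * v k with hH
  set M := max (H - 3 / 2 * δ) 0 with hM
  have hM0 : 0 ≤ M := le_max_right _ _
  have hM1 : M ≤ 1 := max_le (by linarith) zero_le_one
  have hpt : ∀ i j, (-(M ^ 2) - 9 * γ ^ 2 - 11 * γ + 2 * M * H)
        + (-(2 * M)) * ∑ k, move γ u i k * move γ v j k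
      ≤ -((max ((∑ k, move γ u i k * move γ v j k) - 3 / 2 * δ) 0) ^ 2 + 11 * γ) := by
    intro i j
    have h1 := sq_max_add_le (H - 3 / 2 * δ) ((∑ k, move γ u i k * move γ v j k) - H)
    have h2 : H - 3 / 2 * δ + ((∑ k, move γ u i k * move γ v j k) - H)
        = (∑ k, move γ u i k * move γ v j k) - 3 / 2 * δ := by ring
    rw [h2, ← hM] at h1
    have h3 : ((∑ k, move γ u i k * move γ v j k) - H) ^ 2 ≤ (3 * γ) ^ 2 := by
      rw [overlap_move, ← hH]
      apply sq_le_sq'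
      · have := hu.1 j
        have := hv.1 i
        have a1 : 0 ≤ γ * (1 - γ) * (v i + u j) :=
          mul_nonneg (mul_nonneg hγ.le (by linarith)) (by linarith)
        have a2 : 0 ≤ γ ^ 2 * (if i = j then (1 : ℝ) else 0) := by positivity
        nlinarith
      · have := le_one_of_mem_stdSimplex hu j
        have := le_one_of_mem_stdSimplex hv i
        have a1 : γ * (1 - γ) * (v i + u j) ≤ γ * (1 - γ) * 2 :=
          mul_le_mul_of_nonneg_left (by linarith) (mul_nonneg hγ.le (by linarith))
        have a2 : γ ^ 2 * (if i = j then (1 : ℝ) else 0) ≤ γ ^ 2 * 1 :=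
          mul_le_mul_of_nonneg_left (by split_ifs <;> norm_num) (sq_nonneg γ)
        nlinarith
    linarith
  have hstep := nextExp_affine_overlap (α := α) hd hδ γ
    (-(M ^ 2) - 9 * γ ^ 2 - 11 * γ + 2 * M * H) (-(2 * M)) u v
  have hmono := nextExp_mono (α := α) hδ (γ := γ) (u := u) (v := v)
    (V := fun u v => (-(M ^ 2) - 9 * γ ^ 2 - 11 * γ + 2 * M * H) + (-(2 * M)) * ∑ k, u k * v k)
    (V' := fun u v => -((max ((∑ k, u k * v k) - 3 / 2 * δ) 0) ^ 2 + 11 * γ)) hpt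
  rw [hstep, ← hH] at hmono
  refine le_trans ?_ hmono
  have hMG : 0 ≤ M * decay d δ α u v := by
    rcases le_total (3 / 2 * δ) H with h | h
    · exact mul_nonneg hM0 (decay_nonneg hd hδ hα hu hv h)
    · have : M = 0 := max_eq_right (by linarith)
      simp [this]
  have h1 := (sum_mul_nonneg_le_one (piv_mem (α := α) hd hδ v) (piv_mem (α := α) hd hδ u)).2
  have h4 : M * γ ^ 2 * ((∑ i, piv d δ α v i * piv d δ α u i) - H) ≤ 1 * γ ^ 2 * 1 := by
    refine mul_le_mul_of_nonneg (mul_le_mul_of_nonneg_right hM1 (sq_nonneg γ)) (by linarith)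
      (by positivity) zero_le_one
  have h5 : γ * γ ≤ s * γ := mul_le_mul_of_nonneg_right hγs hγ.le
  have h6 : 0 ≤ γ * (1 - γ) * (M * decay d δ α u v) :=
    mul_nonneg (mul_nonneg hγ.le (by linarith)) hMG
  linarith

lemma sub_two_mul_sq_le_log {R R' : ℝ} (hR : 0 < R) (h : (R' - R) ^ 2 ≤ R ^ 2 / 4) :
    Real.log R + (R' - R) / R - 2 * (R' - R) ^ 2 / R ^ 2 ≤ Real.log R' := by
  have h1 : R / 2 ≤ R' := by
    have := abs_le_of_sq_le_sq' (show (R' - R) ^ 2 ≤ (R / 2) ^ 2 by linarith) (by linarith)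
    linarith [this.1]
  have hR' : 0 < R' := by linarith
  have h2 := Real.one_sub_inv_le_log_of_pos (div_pos hR' hR)
  rw [Real.log_div hR'.ne' hR.ne', inv_div] at h2
  have h3 : (R' - R) / R - 2 * (R' - R) ^ 2 / R ^ 2 ≤ 1 - R / R' := by
    have e : 1 - R / R' - ((R' - R) / R - 2 * (R' - R) ^ 2 / R ^ 2)
        = (R' - R) ^ 2 * (2 * R' - R) / (R' * R ^ 2) := by
      field_simp
      ring
    have : 0 ≤ (R' - R) ^ 2 * (2 * R' - R) / (R' * R ^ 2) :=
      div_nonneg (mul_nonneg (sq_nonneg _) (by linarith)) (by positivity)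
    linarith
  linarith

lemma sqDist_le_two {u v : Fin d → ℝ} (hu : u ∈ stdSimplex ℝ (Fin d))
    (hv : v ∈ stdSimplex ℝ (Fin d)) : ∑ k, (u k - v k) ^ 2 ≤ 2 := by
  have h1 : ∀ i, (u i - v i) ^ 2 ≤ u i + v i := by
    intro i
    have a1 := hu.1 i
    have a2 := hv.1 i
    have a3 := le_one_of_mem_stdSimplex hu i
    have a4 := le_one_of_mem_stdSimplex hv i
    nlinarith [mul_nonneg a1 a2, mul_nonneg a1 (sub_nonneg.2 a3), mul_nonneg a2 (sub_nonneg.2 a4)]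
  calc ∑ k, (u k - v k) ^ 2 ≤ ∑ i, (u i + v i) := Finset.sum_le_sum fun i _ => h1 i
    _ = 2 := by rw [Finset.sum_add_distrib, hu.2, hv.2]; norm_num

lemma add_add_sq_le (x y z : ℝ) : (x + y + z) ^ 2 ≤ 3 * (x ^ 2 + y ^ 2 + z ^ 2) := by
  nlinarith [sq_nonneg (x - y), sq_nonneg (x - z), sq_nonneg (y - z)]

lemma sqDist_move_sub_sq_le {u v : Fin d → ℝ} (hu : u ∈ stdSimplex ℝ (Fin d))
    (hv : v ∈ stdSimplex ℝ (Fin d)) {s γ : ℝ} (hγ : 0 < γ) (hγ1 : γ ≤ 1) (hγs : γ ≤ s)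
    (hs2 : s ≤ 2 * γ) (hsγ : s - γ = s * γ) (i j : Fin d) :
    ((∑ k, (move γ u i k - move γ v j k) ^ 2) + γ / 4 - ((∑ k, (u k - v k) ^ 2) + s / 4)) ^ 2
      ≤ 72 * γ ^ 2 * ∑ k, (u k - v k) ^ 2 + 12 * γ ^ 4 := by
  have hUk : ∀ i, (u i - v i) ^ 2 ≤ ∑ k, (u k - v k) ^ 2 := fun i =>
    Finset.single_le_sum (f := fun i => (u i - v i) ^ 2) (fun _ _ => sq_nonneg _)
      (Finset.mem_univ i)
  have hU2 := sqDist_le_two hu hv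
  have hUi := hUk i
  have hUj := hUk j
  rw [sqDist_move]
  generalize ∑ k, (u k - v k) ^ 2 = U at *
  have hU0 : 0 ≤ U := (sq_nonneg _).trans hUi
  set b := (u i - v i) - (u j - v j) with hb
  set e : ℝ := 2 - 2 * (if i = j then 1 else 0) with he
  have he0 : 0 ≤ e ∧ e ≤ 2 := by rw [he]; split_ifs <;> norm_num
  have hb2 : b ^ 2 ≤ 4 * U := by
    nlinarith [sq_nonneg ((u i - v i) + (u j - v j))]
  have hsg : s * γ ≤ 2 * γ ^ 2 := by nlinarith
  have e1 : (1 - γ) ^ 2 * U + 2 * γ * (1 - γ) * b + γ ^ 2 * e + γ / 4 - (U + s / 4)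
      = -(γ * (2 - γ) * U) + 2 * γ * (1 - γ) * b + (γ ^ 2 * e - s * γ / 4) := by
    rw [← hsγ]; ring
  rw [e1]
  have t1 : (-(γ * (2 - γ) * U)) ^ 2 ≤ 8 * γ ^ 2 * U := by
    have : (2 - γ) ^ 2 ≤ 4 := by nlinarith
    have h2 : U ^ 2 ≤ 2 * U := by nlinarith
    calc (-(γ * (2 - γ) * U)) ^ 2 = γ ^ 2 * ((2 - γ) ^ 2 * U ^ 2) := by ring
      _ ≤ γ ^ 2 * (4 * (2 * U)) := by gcongr
      _ = 8 * γ ^ 2 * U := by ring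
  have t2 : (2 * γ * (1 - γ) * b) ^ 2 ≤ 16 * γ ^ 2 * U := by
    have : (1 - γ) ^ 2 ≤ 1 := by nlinarith
    calc (2 * γ * (1 - γ) * b) ^ 2 = 4 * γ ^ 2 * ((1 - γ) ^ 2 * b ^ 2) := by ring
      _ ≤ 4 * γ ^ 2 * (1 * (4 * U)) := by gcongr
      _ = 16 * γ ^ 2 * U := by ring
  have t3 : (γ ^ 2 * e - s * γ / 4) ^ 2 ≤ (2 * γ ^ 2) ^ 2 := by
    have h1 : 0 ≤ γ ^ 2 * e := mul_nonneg (sq_nonneg γ) he0.1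
    have h2 : γ ^ 2 * e ≤ γ ^ 2 * 2 := mul_le_mul_of_nonneg_left he0.2 (sq_nonneg γ)
    have h3 : 0 ≤ s * γ := mul_nonneg (by linarith) hγ.le
    apply sq_le_sq' <;> linarith
  refine (add_add_sq_le _ _ _).trans ?_
  linarith

lemma log_add_le_nextExp (hd : 0 < d) (hδ : 0 < δ) {u v : Fin d → ℝ}
    (hu : u ∈ stdSimplex ℝ (Fin d)) (hv : v ∈ stdSimplex ℝ (Fin d))
    (hmono : 600 * ∑ i, (u i - v i) ^ 2
      ≤ ∑ i, (piv d δ α v i - piv d δ α u i) * (u i - v i))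
    (hpq : ∑ i, piv d δ α v i * piv d δ α u i ≤ 1 / 2)
    {s γ : ℝ} (hγ : 0 < γ) (hγ1 : γ ≤ 1 / 2000) (hγs : γ ≤ s) (hs2 : s ≤ 2 * γ)
    (hsγ : s - γ = s * γ) :
    Real.log ((∑ k, (u k - v k) ^ 2) + s / 4) + γ / 2
      ≤ nextExp d δ α γ (fun u v => Real.log ((∑ k, (u k - v k) ^ 2) + γ / 4)) u v := by
  set U := ∑ k, (u k - v k) ^ 2 with hU
  have hU0 : 0 ≤ U := Finset.sum_nonneg fun _ _ => sq_nonneg _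
  set R := U + s / 4 with hR
  have hRγ : γ / 4 ≤ R := by linarith
  have hR0 : 0 < R := by linarith
  have hRU : R ≤ U + γ / 2 := by linarith
  set B := 72 * γ ^ 2 * U + 12 * γ ^ 4 with hB
  have hsq : ∀ i j, ((∑ k, (move γ u i k - move γ v j k) ^ 2) + γ / 4 - R) ^ 2 ≤ B :=
    sqDist_move_sub_sq_le hu hv hγ (by linarith) hγs hs2 hsγ
  have hBR : B ≤ R ^ 2 / 4 := by
    have h1 : γ / 4 * R ≤ R * R := mul_le_mul_of_nonneg_right hRγ hR0.le
    have h2 : γ ^ 2 * U ≤ γ / 2000 * R := by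
      have : γ * (γ * U) ≤ 1 / 2000 * (γ * R) :=
        mul_le_mul hγ1 (mul_le_mul_of_nonneg_left (by linarith) hγ.le)
          (mul_nonneg hγ.le hU0) (by norm_num)
      linarith
    have h3 : γ ^ 4 ≤ γ / 1000000 * R := by
      have h4 : γ ^ 2 ≤ (1 / 2000) ^ 2 := pow_le_pow_left₀ hγ.le hγ1 2
      have h5 : γ * γ ≤ γ * (4 * R) := mul_le_mul_of_nonneg_left (by linarith) hγ.le
      have := mul_le_mul h4 h5 (by positivity) (by norm_num)
      linarith
    rw [hB]
    have : 0 ≤ γ * R := by positivity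
    linarith
  have hpt : ∀ i j, (Real.log R - 2 * B / R ^ 2 - 1 + γ / 4 / R)
        + (1 / R) * ∑ k, (move γ u i k - move γ v j k) ^ 2
      ≤ Real.log ((∑ k, (move γ u i k - move γ v j k) ^ 2) + γ / 4) := by
    intro i j
    have h1 := sub_two_mul_sq_le_log hR0 ((hsq i j).trans hBR)
    have h2 : 2 * ((∑ k, (move γ u i k - move γ v j k) ^ 2) + γ / 4 - R) ^ 2 / R ^ 2
        ≤ 2 * B / R ^ 2 := by
      have := hsq i j
      gcongr
    have h3 : ((∑ k, (move γ u i k - move γ v j k) ^ 2) + γ / 4 - R) / R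
        = (1 / R) * (∑ k, (move γ u i k - move γ v j k) ^ 2) + γ / 4 / R - 1 := by
      field_simp
    linarith
  refine le_trans ?_ (pairExp_mono (fun i => piv_nonneg hδ v i) (fun i => piv_nonneg hδ u i) hpt)
  have e : ∀ i j, (Real.log R - 2 * B / R ^ 2 - 1 + γ / 4 / R)
        + (1 / R) * ∑ k, (move γ u i k - move γ v j k) ^ 2
      = (Real.log R - 2 * B / R ^ 2 - 1 + γ / 4 / R + (1 / R) * ((1 - γ) ^ 2 * U + 2 * γ ^ 2))
        + (1 / R) * (2 * γ * (1 - γ)) * (u i - v i)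
        + -((1 / R) * (2 * γ * (1 - γ))) * (u j - v j)
        + -((1 / R) * (2 * γ ^ 2)) * (if i = j then 1 else 0) := by
    intro i j
    rw [sqDist_move]
    ring
  simp only [e]
  rw [pairExp_affine (sum_piv hd hδ v) (sum_piv hd hδ u)]
  simp only [mul_left_comm (piv d δ α _ _), ← Finset.mul_sum]
  simp only [sub_mul, Finset.sum_sub_distrib] at hmono
  set P := ∑ i, piv d δ α v i * (u i - v i)
  set Q := ∑ i, piv d δ α u i * (u i - v i)
  set T := ∑ i, piv d δ α v i * piv d δ α u i
  have hdrift : γ * 598 * U + γ ^ 2 / 2 ≤ (1 - γ) ^ 2 * U + 2 * γ ^ 2 + 2 * γ * (1 - γ) * (P - Q)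
      - 2 * γ ^ 2 * T + γ / 4 - R := by
    have h1 : γ * (600 * U) ≤ 2 * γ * (1 - γ) * (P - Q) := by
      have := mul_le_mul (show γ ≤ 2 * γ * (1 - γ) by nlinarith) hmono (by positivity)
        (by nlinarith)
      exact this
    have h2 : γ ^ 2 * T ≤ γ ^ 2 * (1 / 2) := mul_le_mul_of_nonneg_left hpq (sq_nonneg γ)
    have h3 : 0 ≤ γ ^ 2 * U := by positivity
    have h4 : s * γ ≤ 2 * γ * γ := mul_le_mul_of_nonneg_right hs2 hγ.le
    rw [hR]
    linarith
  have hfinal : γ / 2 * R ^ 2 ≤ (γ * 598 * U + γ ^ 2 / 2) * R - 2 * B := by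
    have h1 : γ * U * (γ / 4) ≤ γ * U * R := mul_le_mul_of_nonneg_left hRγ (by positivity)
    have h2 : γ ^ 3 * (γ / 4) ≤ γ ^ 3 * R := mul_le_mul_of_nonneg_left hRγ (by positivity)
    have h3 : γ ^ 3 * R ≤ γ ^ 2 * R * (1 / 2000) := by
      have := mul_le_mul_of_nonneg_left hγ1 (show 0 ≤ γ ^ 2 * R by positivity)
      linarith
    have h4 : γ / 2 * R * R ≤ γ / 2 * R * (U + γ / 2) :=
      mul_le_mul_of_nonneg_left hRU (by positivity)
    have h5 : 0 ≤ γ * U * R := by positivity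
    have h6 : 0 ≤ γ ^ 2 * R := by positivity
    rw [hB]
    linarith
  have hgain : γ / 2 ≤ (γ * 598 * U + γ ^ 2 / 2) / R - 2 * B / R ^ 2 := by
    have e1 : (γ * 598 * U + γ ^ 2 / 2) / R - 2 * B / R ^ 2
        = ((γ * 598 * U + γ ^ 2 / 2) * R - 2 * B) / R ^ 2 := by
      field_simp
    rw [e1, le_div_iff₀ (by positivity)]
    exact hfinal
  have hdiv := div_le_div_of_nonneg_right hdrift hR0.le
  have e2 : ((1 - γ) ^ 2 * U + 2 * γ ^ 2 + 2 * γ * (1 - γ) * (P - Q) - 2 * γ ^ 2 * T + γ / 4 - R) / R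
      = 1 / R * ((1 - γ) ^ 2 * U + 2 * γ ^ 2) + 1 / R * (2 * γ * (1 - γ)) * P
        + -(1 / R * (2 * γ * (1 - γ))) * Q + -(1 / R * (2 * γ ^ 2)) * T + γ / 4 / R - 1 := by
    field_simp
    ring
  linarith

/-- Near the uniform vector, `piv` acts on mass-preserving perturbations like `-α`. -/
lemma exists_local_monotone (hd : 2 < d) (hδ : 0 < δ) (hδd : δ < 1 / d) :
    ∃ r > 0, ∀ u ∈ stdSimplex ℝ (Fin d), ∀ v ∈ stdSimplex ℝ (Fin d), unifDist d u v ≤ r →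
      (α - 1) * ∑ i, (u i - v i) ^ 2
          ≤ ∑ i, (piv d δ α v i - piv d δ α u i) * (u i - v i) ∧
        ∑ i, piv d δ α v i * piv d δ α u i ≤ 1 / 2 := by
  have hd1 : 0 < d := by omega
  have hd0 : (0 : ℝ) < d := by exact_mod_cast hd1
  set s₀ : ℝ := 1 / d with hs₀
  have hs0 : 0 < s₀ := by positivity
  set x₀ : Fin d → ℝ := fun _ => s₀ with hx₀
  have hh : HasStrictDerivAt (fun s => (max δ s) ^ (-α)) (-α * s₀ ^ (-α - 1)) s₀ := by
    refine (Real.hasStrictDerivAt_rpow_const (Or.inl hs0.ne')).congr_of_eventuallyEq ?_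
    filter_upwards [lt_mem_nhds hδd] with s hs
    rw [max_eq_right hs.le]
  have hcoord : ∀ k : Fin d, HasStrictFDerivAt (fun x : Fin d → ℝ => (max δ (x k)) ^ (-α))
      ((-α * s₀ ^ (-α - 1)) • (ContinuousLinearMap.proj k : (Fin d → ℝ) →L[ℝ] ℝ)) x₀ := fun k =>
    HasStrictDerivAt.comp_hasStrictFDerivAt (h₂ := fun s => (max δ s) ^ (-α)) x₀ hh
      (ContinuousLinearMap.proj (R := ℝ) (φ := fun _ : Fin d => ℝ) k).hasStrictFDerivAt
  have hsum := HasStrictFDerivAt.fun_sum (u := Finset.univ) fun k _ => hcoord k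
  have hval : ∑ k : Fin d, (max δ (x₀ k)) ^ (-α) = d * s₀ ^ (-α) := by
    simp [hx₀, max_eq_right hδd.le]
  have hSpos : 0 < (d : ℝ) * s₀ ^ (-α) := mul_pos hd0 (Real.rpow_pos_of_pos hs0 _)
  have hinv := HasStrictDerivAt.comp_hasStrictFDerivAt (h₂ := fun s : ℝ => s⁻¹) x₀
    (hasStrictDerivAt_inv (by rw [hval]; exact hSpos.ne')) hsum
  have hpiv : ∀ i : Fin d, ∃ L : (Fin d → ℝ) →L[ℝ] ℝ,
      HasStrictFDerivAt (fun x => piv d δ α x i) L x₀ ∧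
        ∀ w : Fin d → ℝ, ∑ k, w k = 0 → L w = -α * w i := by
    intro i
    refine ⟨_, (hcoord i).mul hinv, fun w hw => ?_⟩
    simp only [add_apply, smul_apply, _root_.sum_apply, ContinuousLinearMap.proj_apply, smul_eq_mul,
      ← Finset.mul_sum, hw, hval]
    have h1 : s₀ ^ (-α - 1) = s₀ ^ (-α) * d := by
      rw [Real.rpow_sub_one hs0.ne', hs₀]
      field_simp
    rw [h1]
    have := Real.rpow_pos_of_pos hs0 (-α)
    field_simp
    ring
  choose L hL hLw using hpiv
  have hev : ∀ᶠ z in nhds (x₀, x₀), (∀ i, ‖piv d δ α z.1 i - piv d δ α z.2 i - L i (z.1 - z.2)‖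
      ≤ 1 / d * ‖z.1 - z.2‖) ∧ ∑ i, piv d δ α z.1 i * piv d δ α z.2 i < 1 / 2 := by
    refine Filter.Eventually.and ?_ ?_
    · rw [Filter.eventually_all]
      intro i
      exact (hL i).isLittleO.bound (by positivity)
    · have hc : Continuous fun z : (Fin d → ℝ) × (Fin d → ℝ) =>
          ∑ i, piv d δ α z.1 i * piv d δ α z.2 i :=
        continuous_finsetSum _ fun i _ => ((continuous_piv hd1 hδ i).comp continuous_fst).mul
          ((continuous_piv hd1 hδ i).comp continuous_snd)
      refine hc.continuousAt.eventually (gt_mem_nhds ?_)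
      have : ∀ i, piv d δ α x₀ i = 1 / d := by
        intro i
        unfold piv
        rw [hval]
        simp only [hx₀, max_eq_right hδd.le]
        have := Real.rpow_pos_of_pos hs0 (-α)
        field_simp
      have h3 : (2 : ℝ) < d := by exact_mod_cast hd
      simp only [this, Finset.sum_const, Finset.card_univ, Fintype.card_fin, nsmul_eq_mul]
      have e : (d : ℝ) * (1 / d * (1 / d)) = 1 / d := by field_simp
      rw [e]
      exact one_div_lt_one_div_of_lt (by norm_num) h3
  obtain ⟨ε, hε, hball⟩ := Metric.eventually_nhds_iff.1 hev
  refine ⟨(ε / 2) ^ 2, by positivity, fun u hu v hv huv => ?_⟩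
  have hclose : ∀ w : Fin d → ℝ, ∑ i, (w i - 1 / d) ^ 2 ≤ (ε / 2) ^ 2 → dist w x₀ < ε := by
    intro w hw
    refine (dist_pi_lt_iff hε).2 fun i => ?_
    have h1 : (w i - 1 / d) ^ 2 ≤ (ε / 2) ^ 2 :=
      (Finset.single_le_sum (f := fun i => (w i - 1 / (d : ℝ)) ^ 2) (fun _ _ => sq_nonneg _)
        (Finset.mem_univ i)).trans hw
    have := abs_le_of_sq_le_sq h1 (by positivity)
    rw [Real.dist_eq]
    exact this.trans_lt (by linarith)
  unfold unifDist at huv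
  have hu' := hclose u (le_trans (le_add_of_nonneg_right
    (Finset.sum_nonneg fun _ _ => sq_nonneg _)) huv)
  have hv' := hclose v (le_trans (le_add_of_nonneg_left
    (Finset.sum_nonneg fun _ _ => sq_nonneg _)) huv)
  obtain ⟨h1, h2⟩ := hball (y := (v, u)) (by rw [Prod.dist_eq]; exact max_lt hv' hu')
  refine ⟨?_, h2.le⟩
  have hw0 : ∑ k, (v - u) k = 0 := by simp [Finset.sum_sub_distrib, hu.2, hv.2]
  set U := ∑ i, (u i - v i) ^ 2 with hU
  have hnorm : ‖v - u‖ ^ 2 ≤ U := by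
    have : ‖v - u‖ ≤ √U := by
      refine (pi_norm_le_iff_of_nonneg (Real.sqrt_nonneg _)).2 fun i => ?_
      rw [Real.norm_eq_abs]
      apply Real.abs_le_sqrt
      calc ((v - u) i) ^ 2 = (u i - v i) ^ 2 := by simp only [Pi.sub_apply]; ring
        _ ≤ U := Finset.single_le_sum (f := fun i => (u i - v i) ^ 2) (fun _ _ => sq_nonneg _)
          (Finset.mem_univ i)
    calc ‖v - u‖ ^ 2 ≤ √U ^ 2 := by gcongr
      _ = U := Real.sq_sqrt (Finset.sum_nonneg fun _ _ => sq_nonneg _)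
  have hterm : ∀ i, α * (u i - v i) ^ 2 - 1 / d * ‖v - u‖ ^ 2
      ≤ (piv d δ α v i - piv d δ α u i) * (u i - v i) := by
    intro i
    have h3 := h1 i
    rw [hLw i _ hw0, Real.norm_eq_abs] at h3
    simp only [Pi.sub_apply] at h3
    have h4 : |u i - v i| ≤ ‖v - u‖ := by
      rw [abs_sub_comm]
      exact norm_le_pi_norm (v - u) i
    have h5 := mul_le_mul h3 h4 (abs_nonneg _) (by positivity)
    rw [← abs_mul] at h5
    have h6 := (abs_le.1 h5).1
    linarith
  have h7 := Finset.sum_le_sum fun i (_ : i ∈ Finset.univ) => hterm i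
  rw [Finset.sum_sub_distrib, ← Finset.mul_sum, Finset.sum_const, Finset.card_univ,
    Fintype.card_fin, nsmul_eq_mul, ← hU] at h7
  have e : (d : ℝ) * (1 / d * ‖v - u‖ ^ 2) = ‖v - u‖ ^ 2 := by field_simp
  linarith

end OneStep

section Walk

variable {d : ℕ} {δ α : ℝ}

/-- The step size `1 / (n + d)` of the occupation vector at time `n`. -/
noncomputable def step (d n : ℕ) : ℝ := 1 / (n + d)

lemma step_pos (hd : 0 < d) (n : ℕ) : 0 < step d n := by
  unfold step
  positivity

lemma step_succ_sub (hd : 0 < d) (n : ℕ) :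
    step d n - step d (n + 1) = step d n * step d (n + 1) := by
  have h1 : (n : ℝ) + d ≠ 0 := by positivity
  have h2 : (n : ℝ) + 1 + d ≠ 0 := by positivity
  unfold step
  push_cast
  field_simp
  ring

lemma step_succ_le (hd : 0 < d) (n : ℕ) : step d (n + 1) ≤ step d n := by
  have := mul_pos (step_pos hd n) (step_pos hd (n + 1))
  linarith [step_succ_sub hd n]

lemma step_le_inv {m n : ℕ} (hm : 0 < m) (h : m ≤ n + d) : step d n ≤ 1 / m := by
  unfold step
  have h1 : (m : ℝ) ≤ n + d := by exact_mod_cast h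
  have h2 : (0 : ℝ) < m := by exact_mod_cast hm
  exact one_div_le_one_div_of_le h2 h1

lemma step_le_two_mul (hd : 0 < d) (n : ℕ) : step d n ≤ 2 * step d (n + 1) := by
  have h1 : step d n ≤ 1 := by
    simpa using step_le_inv (d := d) (m := 1) (n := n) one_pos (by omega)
  have h2 := mul_le_mul_of_nonneg_right h1 (step_pos hd (n + 1)).le
  linarith [step_succ_sub hd n]

lemma step_add (d m n : ℕ) : step d (n + m) = 1 / ((n + (m + d) : ℕ) : ℝ) := by
  unfold step
  push_cast
  ring

lemma not_summable_step (d m : ℕ) : ¬ Summable fun n => step d (n + m) := by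
  simp only [step_add]
  exact mt (summable_nat_add_iff (m + d) (f := fun n : ℕ => 1 / (n : ℝ))).1
    Real.not_summable_one_div_natCast

lemma summable_step_sq (d m : ℕ) : Summable fun n => step d (n + m) ^ 2 := by
  simp only [step_add, div_pow, one_pow]
  exact (summable_nat_add_iff (m + d) (f := fun n : ℕ => 1 / (n : ℝ) ^ 2)).2
    (Real.summable_one_div_nat_pow.2 one_lt_two)

lemma tendsto_step (d : ℕ) : Tendsto (fun n => step d n) atTop (nhds 0) := by
  have h := (tendsto_add_atTop_iff_nat (0 + d) (f := fun n : ℕ => 1 / (n : ℝ))).2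
    tendsto_one_div_atTop_nhds_zero_nat
  simpa only [← step_add, add_zero] using h

/-- A nonnegative sequence moving at speed at most `C * γ` with `∑ γ * w < ∞` tends to zero. -/
lemma tendsto_zero_of_slow {γ w : ℕ → ℝ} {C : ℝ} (hγ0 : ∀ n, 0 ≤ γ n)
    (hγ : ¬ Summable γ) (hγ2 : Summable fun n => γ n ^ 2) (hw : ∀ n, 0 ≤ w n)
    (hslow : ∀ n, |w (n + 1) - w n| ≤ C * γ n) (hsum : Summable fun n => γ n * w n) :
    Tendsto w atTop (nhds 0) := by
  have hdist : ∀ n, dist (w n ^ 2) (w (n + 1) ^ 2)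
      ≤ 2 * C * (γ n * w n) + C ^ 2 * γ n ^ 2 := by
    intro n
    have h1 := hslow n
    have h0 : 0 ≤ C * γ n := (abs_nonneg _).trans h1
    have h2 : |w (n + 1) + w n| ≤ 2 * w n + C * γ n := by
      rw [abs_of_nonneg (add_nonneg (hw _) (hw _))]
      linarith [(abs_le.1 h1).2]
    rw [dist_comm, Real.dist_eq, sq_sub_sq, mul_comm, abs_mul]
    calc |w (n + 1) - w n| * |w (n + 1) + w n| ≤ C * γ n * (2 * w n + C * γ n) :=
          mul_le_mul h1 h2 (abs_nonneg _) h0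
      _ = _ := by ring
  have hc : CauchySeq fun n => w n ^ 2 := cauchySeq_of_summable_dist <|
    Summable.of_nonneg_of_le (fun _ => dist_nonneg) hdist
      ((hsum.mul_left _).add (hγ2.mul_left _))
  obtain ⟨L, hL⟩ := cauchySeq_tendsto_of_complete hc
  have hL0 : 0 ≤ L := ge_of_tendsto' hL fun n => sq_nonneg _
  rcases hL0.eq_or_lt with rfl | hLpos
  · have h := (Real.continuous_sqrt.tendsto 0).comp hL
    simpa [Function.comp_def, Real.sqrt_sq (hw _)] using h
  · refine absurd ?_ hγ
    have hs := Real.sqrt_pos.2 (half_pos hLpos)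
    have h1 : ∀ᶠ n in atTop, ‖γ n‖ ≤ (√(L / 2))⁻¹ * (γ n * w n) := by
      filter_upwards [hL.eventually (lt_mem_nhds (half_lt_self hLpos))] with n hn
      have h2 : √(L / 2) ≤ w n := Real.sqrt_le_iff.2 ⟨hw n, hn.le⟩
      have h3 := mul_le_mul_of_nonneg_left h2 (hγ0 n)
      rw [Real.norm_of_nonneg (hγ0 n), inv_mul_eq_div, le_div_iff₀ hs]
      exact h3
    exact Summable.of_norm_bounded_eventually_nat (hsum.mul_left _) h1

variable {Ω : Type}

lemma occ_succ (hd : 0 < d) (X : ℕ → Ω → Fin d) (n : ℕ) (ω : Ω) :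
    occ d X (n + 1) ω = move (step d (n + 1)) (occ d X n ω) (X (n + 1) ω) := by
  funext i
  have h1 : (n : ℝ) + d ≠ 0 := by positivity
  have h2 : (n : ℝ) + 1 + d ≠ 0 := by positivity
  have h3 : Finset.Icc 1 (n + 1) = insert (n + 1) (Finset.Icc 1 n) := by
    ext k
    simp only [Finset.mem_Icc, Finset.mem_insert]
    omega
  simp only [occ, move, step]
  rw [h3, Finset.filter_insert]
  split_ifs
  · rw [Finset.card_insert_of_notMem (by simp)]
    push_cast
    field_simp
    ring
  · push_cast
    field_simp
    ring

lemma occ_mem (hd : 0 < d) (X : ℕ → Ω → Fin d) (n : ℕ) (ω : Ω) :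
    occ d X n ω ∈ stdSimplex ℝ (Fin d) := by
  have h1 : (n : ℝ) + d ≠ 0 := by positivity
  refine ⟨fun i => by unfold occ; positivity, ?_⟩
  unfold occ
  rw [← Finset.sum_div, Finset.sum_add_distrib, ← Nat.cast_sum,
    ← Finset.card_eq_sum_card_fiberwise (fun _ _ => Finset.mem_univ _)]
  simp
  field_simp
  ring

/-- The joint trajectory of the two walks up to time `n`. -/
def hist (X Y : ℕ → Ω → Fin d) (n : ℕ) (ω : Ω) : Fin (n + 1) → Fin d × Fin d :=
  fun k => (X k ω, Y k ω)

lemma occ_eq_of_hist_eq {X Y : ℕ → Ω → Fin d} {n : ℕ} {ω ω' : Ω}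
    (h : hist X Y n ω = hist X Y n ω') {k : ℕ} (hk : k ≤ n) :
    occ d X k ω = occ d X k ω' ∧ occ d Y k ω = occ d Y k ω' := by
  have h1 : ∀ m ∈ Finset.Icc 1 k, (X m ω, Y m ω) = (X m ω', Y m ω') := fun m hm =>
    congrFun h ⟨m, by have := (Finset.mem_Icc.1 hm).2; omega⟩
  constructor <;> funext i <;> unfold occ <;> congr 4 <;>
    refine Finset.filter_congr fun m hm => ?_
  · rw [(Prod.mk.inj (h1 m hm)).1]
  · rw [(Prod.mk.inj (h1 m hm)).2]

lemma exists_bound_of_factorsThrough {X Y : ℕ → Ω → Fin d} {n : ℕ} {f : Ω → ℝ}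
    (hf : f.FactorsThrough (hist X Y n)) : ∃ C, ∀ ω, ‖f ω‖ ≤ C := by
  obtain ⟨g, rfl⟩ := (Function.factorsThrough_iff f).1 hf
  obtain ⟨C, hC⟩ := (Set.finite_range fun x => ‖g x‖).bddAbove
  exact ⟨C, fun ω => hC ⟨_, rfl⟩⟩

/-- The interacting walk: each particle jumps according to the occupation vector of the other. -/
structure IsPairWalk {mΩ : MeasurableSpace Ω} (δ α : ℝ) (P : Measure Ω) (ℱ : Filtration ℕ mΩ)
    (X Y : ℕ → Ω → Fin d) : Prop where
  measurable_left : ∀ n, Measurable[ℱ n] (X n)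
  measurable_right : ∀ n, Measurable[ℱ n] (Y n)
  law : ∀ (n : ℕ) (i j : Fin d),
    (P[(fun ω => (if X (n + 1) ω = i then (1 : ℝ) else 0) *
        (if Y (n + 1) ω = j then (1 : ℝ) else 0)) | ℱ n]) =ᵐ[P]
      fun ω => piv d δ α (occ d Y n ω) i * piv d δ α (occ d X n ω) j

namespace IsPairWalk

variable {mΩ : MeasurableSpace Ω} {P : Measure Ω} {ℱ : Filtration ℕ mΩ} {X Y : ℕ → Ω → Fin d}

lemma measurable_hist (h : IsPairWalk δ α P ℱ X Y) (n : ℕ) : Measurable[ℱ n] (hist X Y n) := by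
  refine @measurable_pi_lambda _ _ _ (ℱ n) _ _ fun k => ?_
  have hk : (k : ℕ) ≤ n := by omega
  exact Measurable.prodMk ((h.measurable_left k).mono (ℱ.mono hk) le_rfl)
    ((h.measurable_right k).mono (ℱ.mono hk) le_rfl)

lemma stronglyMeasurable (h : IsPairWalk δ α P ℱ X Y) {n : ℕ} {f : Ω → ℝ}
    (hf : f.FactorsThrough (hist X Y n)) : StronglyMeasurable[ℱ n] f := by
  obtain ⟨g, rfl⟩ := (Function.factorsThrough_iff f).1 hf
  exact ((measurable_of_finite g).comp (h.measurable_hist n)).stronglyMeasurable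

lemma integrable [IsFiniteMeasure P] (h : IsPairWalk δ α P ℱ X Y) {n : ℕ} {f : Ω → ℝ}
    (hf : f.FactorsThrough (hist X Y n)) : Integrable f P := by
  obtain ⟨C, hC⟩ := exists_bound_of_factorsThrough hf
  exact Integrable.of_bound ((h.stronglyMeasurable hf).mono (ℱ.le n)).aestronglyMeasurable C
    (ae_of_all _ hC)

lemma condExp_next [IsFiniteMeasure P] (h : IsPairWalk δ α P ℱ X Y) (hd : 0 < d) (n : ℕ)
    (V : (Fin d → ℝ) → (Fin d → ℝ) → ℝ) :
    P[fun ω => V (occ d X (n + 1) ω) (occ d Y (n + 1) ω) | ℱ n]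
      =ᵐ[P] fun ω => nextExp d δ α (step d (n + 1)) V (occ d X n ω) (occ d Y n ω) := by
  set F : Fin d → Fin d → Ω → ℝ := fun i j ω =>
    V (move (step d (n + 1)) (occ d X n ω) i) (move (step d (n + 1)) (occ d Y n ω) j) with hF
  set I : Fin d → Fin d → Ω → ℝ := fun i j ω =>
    (if X (n + 1) ω = i then (1 : ℝ) else 0) * (if Y (n + 1) ω = j then (1 : ℝ) else 0) with hI
  have hFf : ∀ i j, (F i j).FactorsThrough (hist X Y n) := fun i j ω ω' hω => by
    simp only [hF, (occ_eq_of_hist_eq hω le_rfl).1, (occ_eq_of_hist_eq hω le_rfl).2]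
  have hIf : ∀ i j, (I i j).FactorsThrough (hist X Y (n + 1)) := fun i j ω ω' hω => by
    have := Prod.mk.inj (congrFun hω (Fin.last (n + 1)))
    simp only [Fin.val_last] at this
    simp only [hI, this.1, this.2]
  have hIint : ∀ i j, Integrable (I i j) P := fun i j => h.integrable (hIf i j)
  have hFI : ∀ i j, Integrable (F i j * I i j) P := fun i j => by
    obtain ⟨C, hC⟩ := exists_bound_of_factorsThrough (hFf i j)
    exact (hIint i j).bdd_mul
      ((h.stronglyMeasurable (hFf i j)).mono (ℱ.le n)).aestronglyMeasurable (ae_of_all _ hC)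
  have hdec : (fun ω => V (occ d X (n + 1) ω) (occ d Y (n + 1) ω))
      = ∑ i, ∑ j, F i j * I i j := by
    funext ω
    simp [hF, hI, occ_succ hd]
  rw [hdec]
  have hterm : ∀ i j, P[F i j * I i j | ℱ n] =ᵐ[P] fun ω =>
      F i j ω * (piv d δ α (occ d Y n ω) i * piv d δ α (occ d X n ω) j) := by
    intro i j
    obtain ⟨C, hC⟩ := exists_bound_of_factorsThrough (hFf i j)
    filter_upwards [condExp_stronglyMeasurable_mul_of_bound (ℱ.le n)
      (h.stronglyMeasurable (hFf i j)) (hIint i j) C (ae_of_all _ hC), h.law n i j] with ω h1 h2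
    rw [h1, Pi.mul_apply, h2]
  have hrow : ∀ i, P[∑ j, F i j * I i j | ℱ n] =ᵐ[P] ∑ j, P[F i j * I i j | ℱ n] := fun i =>
    condExp_finsetSum (fun j _ => hFI i j) _
  have hall := condExp_finsetSum (μ := P) (s := Finset.univ) (f := fun i => ∑ j, F i j * I i j)
    (fun i _ => integrable_finsetSum' _ fun j _ => hFI i j) (ℱ n)
  have hterm' := ae_all_iff.2 fun i => ae_all_iff.2 fun j => hterm i j
  filter_upwards [hall, ae_all_iff.2 hrow, hterm'] with ω h1 h2 h3
  rw [h1, Finset.sum_apply]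
  refine Finset.sum_congr rfl fun i _ => ?_
  rw [h2 i, Finset.sum_apply]
  refine Finset.sum_congr rfl fun j _ => ?_
  rw [h3 i j]
  exact mul_comm _ _

/-- A nonpositive potential increasing by `D` in mean while `Good` holds forces `∑ D < ∞`
on the event that `Good` holds forever. -/
lemma ae_summable_of_potential [IsFiniteMeasure P] (h : IsPairWalk δ α P ℱ X Y) (hd : 0 < d)
    (m : ℕ) {Good : (Fin d → ℝ) → (Fin d → ℝ) → Prop}
    {V D : ℕ → (Fin d → ℝ) → (Fin d → ℝ) → ℝ}
    (hV : ∀ n ≥ m, ∀ u ∈ stdSimplex ℝ (Fin d), ∀ v ∈ stdSimplex ℝ (Fin d), V n u v ≤ 0)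
    (hVD : ∀ n ≥ m, ∀ u ∈ stdSimplex ℝ (Fin d), ∀ v ∈ stdSimplex ℝ (Fin d), Good u v →
      0 ≤ D n u v ∧ V n u v + D n u v ≤ nextExp d δ α (step d (n + 1)) (V (n + 1)) u v) :
    ∀ᵐ ω ∂P, (∀ n ≥ m, Good (occ d X n ω) (occ d Y n ω)) →
      Summable fun n => D (n + m) (occ d X (n + m) ω) (occ d Y (n + m) ω) := by
  classical
  set c : ℕ → Ω → ℝ := fun n ω =>
    if ∀ k ≤ n, Good (occ d X (k + m) ω) (occ d Y (k + m) ω) then 1 else 0 with hc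
  have hc0 : ∀ n ω, 0 ≤ c n ω := fun n ω => by simp only [hc]; split_ifs <;> norm_num
  have hcanti : ∀ n ω, c (n + 1) ω ≤ c n ω := fun n ω => by
    simp only [hc]
    split_ifs with h1 h2 h2
    · exact le_rfl
    · exact absurd (fun k hk => h1 k (by omega)) h2
    · exact zero_le_one
    · exact le_rfl
  have hcf : ∀ n, (c n).FactorsThrough (hist X Y (n + m)) := fun n ω ω' hω => by
    have : ∀ k ≤ n, (Good (occ d X (k + m) ω) (occ d Y (k + m) ω)
        ↔ Good (occ d X (k + m) ω') (occ d Y (k + m) ω')) := fun k hk => by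
      obtain ⟨h1, h2⟩ := occ_eq_of_hist_eq hω (show k + m ≤ n + m by omega)
      rw [h1, h2]
    simp only [hc, forall₂_congr this]
  have hfac : ∀ (n : ℕ) (W : (Fin d → ℝ) → (Fin d → ℝ) → ℝ),
      (fun ω => c n ω * W (occ d X (n + m) ω) (occ d Y (n + m) ω)).FactorsThrough
        (hist X Y (n + m)) := fun n W ω ω' hω => by
    obtain ⟨h1, h2⟩ := occ_eq_of_hist_eq hω le_rfl
    simp only [hcf n hω, h1, h2]
  set a : ℕ → ℝ := fun n => ∫ ω, c n ω * V (n + m) (occ d X (n + m) ω) (occ d Y (n + m) ω) ∂P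
    with ha
  set g : ℕ → Ω → ℝ := fun n ω =>
    c n ω * D (n + m) (occ d X (n + m) ω) (occ d Y (n + m) ω) with hg
  have ha0 : ∀ n, a n ≤ 0 := fun n => integral_nonpos fun ω =>
    mul_nonpos_of_nonneg_of_nonpos (hc0 n ω)
      (hV _ (by omega) _ (occ_mem hd X _ ω) _ (occ_mem hd Y _ ω))
  have hcases : ∀ n ω, c n ω = 0 ∨ Good (occ d X (n + m) ω) (occ d Y (n + m) ω) := fun n ω => by
    simp only [hc]
    split_ifs with h1
    · exact Or.inr (h1 n le_rfl)
    · exact Or.inl rfl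
  have hg0 : ∀ n ω, 0 ≤ g n ω := fun n ω => by
    rcases hcases n ω with h1 | h1
    · simp [hg, h1]
    · exact mul_nonneg (hc0 n ω)
        (hVD _ (by omega) _ (occ_mem hd X _ ω) _ (occ_mem hd Y _ ω) h1).1
  have hgint : ∀ n, Integrable (g n) P := fun n => h.integrable (hfac n (D (n + m)))
  have hinc : ∀ n, ∫ ω, g n ω ∂P ≤ a (n + 1) - a n := by
    intro n
    set W : Ω → ℝ := fun ω =>
      V (n + m + 1) (occ d X (n + m + 1) ω) (occ d Y (n + m + 1) ω) with hW
    have hWf : W.FactorsThrough (hist X Y (n + m + 1)) := fun ω ω' hω => by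
      obtain ⟨h1, h2⟩ := occ_eq_of_hist_eq hω le_rfl
      simp only [hW, h1, h2]
    obtain ⟨C, hC⟩ := exists_bound_of_factorsThrough (hcf n)
    have hcW : ∫ ω, (c n * W) ω ∂P = ∫ ω, c n ω * nextExp d δ α (step d (n + m + 1))
        (V (n + m + 1)) (occ d X (n + m) ω) (occ d Y (n + m) ω) ∂P := by
      rw [← integral_condExp (ℱ.le (n + m))]
      refine integral_congr_ae ?_
      filter_upwards [condExp_stronglyMeasurable_mul_of_bound (ℱ.le (n + m))
        (h.stronglyMeasurable (hcf n)) (h.integrable hWf) C (ae_of_all _ hC),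
        h.condExp_next hd (n + m) (V (n + m + 1))] with ω h1 h2
      rw [h1, Pi.mul_apply, h2]
    have hcWint : Integrable (c n * W) P := (h.integrable hWf).bdd_mul
      ((h.stronglyMeasurable (hcf n)).mono (ℱ.le (n + m))).aestronglyMeasurable (ae_of_all _ hC)
    have h1 : a n + ∫ ω, g n ω ∂P ≤ ∫ ω, (c n * W) ω ∂P := by
      rw [hcW, ha, ← integral_add (h.integrable (hfac n (V (n + m)))) (hgint n)]
      refine integral_mono ((h.integrable (hfac n (V (n + m)))).add (hgint n))
        (h.integrable (hfac n _)) fun ω => ?_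
      rcases hcases n ω with h2 | h2
      · simp [hg, h2]
      · simp only [hg, ← mul_add]
        exact mul_le_mul_of_nonneg_left
          (hVD _ (by omega) _ (occ_mem hd X _ ω) _ (occ_mem hd Y _ ω) h2).2 (hc0 n ω)
    have h2 : ∫ ω, (c n * W) ω ∂P ≤ a (n + 1) := by
      have e : n + 1 + m = n + m + 1 := by omega
      have h3 := h.integrable (hfac (n + 1) (V (n + 1 + m)))
      simp only [ha]
      refine integral_mono hcWint h3 fun ω => ?_
      simp only [Pi.mul_apply, hW, e]
      exact mul_le_mul_of_nonpos_right (hcanti n ω)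
        (hV _ (by omega) _ (occ_mem hd X _ ω) _ (occ_mem hd Y _ ω))
    linarith
  have hbound : ∀ N, ∑ n ∈ Finset.range N, ∫ ω, g n ω ∂P ≤ -a 0 := fun N =>
    calc ∑ n ∈ Finset.range N, ∫ ω, g n ω ∂P
        ≤ ∑ n ∈ Finset.range N, (a (n + 1) - a n) := Finset.sum_le_sum fun n _ => hinc n
      _ = a N - a 0 := Finset.sum_range_sub a N
      _ ≤ -a 0 := by linarith [ha0 N]
  have hgsum : Summable fun n => ∫ ω, g n ω ∂P :=
    summable_of_sum_range_le (fun n => integral_nonneg (hg0 n)) hbound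
  have hfin : ∫⁻ ω, ∑' n, ENNReal.ofReal (g n ω) ∂P ≠ ⊤ := by
    rw [lintegral_tsum fun n => (hgint n).aestronglyMeasurable.aemeasurable.ennreal_ofReal]
    simp only [← ofReal_integral_eq_lintegral_ofReal (hgint _) (ae_of_all _ (hg0 _))]
    exact hgsum.tsum_ofReal_ne_top
  have hae : ∀ᵐ ω ∂P, ∑' n, ENNReal.ofReal (g n ω) < ⊤ :=
    ae_lt_top' (AEMeasurable.tsum fun n =>
      (hgint n).aestronglyMeasurable.aemeasurable.ennreal_ofReal) hfin
  filter_upwards [hae] with ω hω hgood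
  have h1 := ENNReal.summable_toReal hω.ne
  refine h1.congr fun n => ?_
  rw [ENNReal.toReal_ofReal (hg0 n ω)]
  simp only [hg, hc]
  rw [if_pos fun k _ => hgood _ (by omega), one_mul]

end IsPairWalk

end Walk

section Convergence

variable {d : ℕ} {δ α : ℝ}

lemma abs_sum_sq_move_sub_le {u : Fin d → ℝ} (hu : u ∈ stdSimplex ℝ (Fin d)) {γ a : ℝ}
    (hγ : 0 ≤ γ) (hγ1 : γ ≤ 1) (ha : 0 ≤ a) (ha1 : a ≤ 1) (i : Fin d) :
    |∑ k, (move γ u i k - a) ^ 2 - ∑ k, (u k - a) ^ 2| ≤ 2 * d * γ := by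
  rw [← Finset.sum_sub_distrib]
  refine (Finset.abs_sum_le_sum_abs _ _).trans ?_
  have hk : ∀ k, |(move γ u i k - a) ^ 2 - (u k - a) ^ 2| ≤ 2 * γ := by
    intro k
    have h0 := hu.1 k
    have h1 := le_one_of_mem_stdSimplex hu k
    obtain ⟨e0, e1⟩ : (0 : ℝ) ≤ (if i = k then 1 else 0) ∧ (if i = k then (1 : ℝ) else 0) ≤ 1 := by
      split_ifs <;> norm_num
    simp only [move]
    generalize (if i = k then (1 : ℝ) else 0) = e at e0 e1
    have hm0 : 0 ≤ (1 - γ) * u k + γ * e :=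
      add_nonneg (mul_nonneg (by linarith) h0) (mul_nonneg hγ e0)
    have hm1 : (1 - γ) * u k + γ * e ≤ 1 := by
      have := mul_le_mul_of_nonneg_left h1 (sub_nonneg.2 hγ1)
      have := mul_le_mul_of_nonneg_left e1 hγ
      linarith
    have e2 : ((1 - γ) * u k + γ * e - a) ^ 2 - (u k - a) ^ 2
        = γ * (e - u k) * (((1 - γ) * u k + γ * e - a) + (u k - a)) := by ring
    have h2 : |γ * (e - u k)| ≤ γ * 1 := by
      rw [abs_mul, abs_of_nonneg hγ]
      exact mul_le_mul_of_nonneg_left (abs_le.2 ⟨by linarith, by linarith⟩) hγ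
    have h3 : |((1 - γ) * u k + γ * e - a) + (u k - a)| ≤ 2 :=
      abs_le.2 ⟨by linarith, by linarith⟩
    rw [e2, abs_mul]
    have := mul_le_mul h2 h3 (abs_nonneg _) (by linarith)
    linarith
  calc ∑ k, |(move γ u i k - a) ^ 2 - (u k - a) ^ 2| ≤ ∑ _k : Fin d, 2 * γ :=
        Finset.sum_le_sum fun k _ => hk k
    _ = 2 * d * γ := by
      rw [Finset.sum_const, Finset.card_univ, Fintype.card_fin, nsmul_eq_mul]
      ring

lemma abs_unifDist_move_sub_le (hd : 0 < d) {u v : Fin d → ℝ} (hu : u ∈ stdSimplex ℝ (Fin d))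
    (hv : v ∈ stdSimplex ℝ (Fin d)) {γ : ℝ} (hγ : 0 ≤ γ) (hγ1 : γ ≤ 1) (i j : Fin d) :
    |unifDist d (move γ u i) (move γ v j) - unifDist d u v| ≤ 4 * d * γ := by
  have ha1 : 1 / (d : ℝ) ≤ 1 := by
    rw [div_le_one (by exact_mod_cast hd)]
    exact_mod_cast hd
  have h1 := abs_le.1 (abs_sum_sq_move_sub_le hu hγ hγ1 (by positivity) ha1 i)
  have h2 := abs_le.1 (abs_sum_sq_move_sub_le hv hγ hγ1 (by positivity) ha1 j)
  unfold unifDist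
  exact abs_le.2 ⟨by linarith [h1.1, h2.1], by linarith [h1.2, h2.2]⟩

lemma unifDist_le_four (hd : 0 < d) {u v : Fin d → ℝ} (hu : u ∈ stdSimplex ℝ (Fin d))
    (hv : v ∈ stdSimplex ℝ (Fin d)) : unifDist d u v ≤ 4 := by
  have hc : (fun _ => 1 / (d : ℝ)) ∈ stdSimplex ℝ (Fin d) := by
    refine ⟨fun _ => by positivity, ?_⟩
    rw [Finset.sum_const, Finset.card_univ, Fintype.card_fin, nsmul_eq_mul]
    field_simp
  have h1 := sqDist_le_two hu hc
  have h2 := sqDist_le_two hv hc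
  unfold unifDist
  linarith

lemma nextExp_sub_const (hd : 0 < d) (hδ : 0 < δ) (γ c : ℝ)
    (V : (Fin d → ℝ) → (Fin d → ℝ) → ℝ) (u v : Fin d → ℝ) :
    nextExp d δ α γ (fun u v => V u v - c) u v = nextExp d δ α γ V u v - c := by
  simp only [nextExp, pairExp, mul_sub, Finset.sum_sub_distrib, ← Finset.sum_mul,
    ← Finset.mul_sum, sum_piv hd hδ, mul_one, one_mul]

namespace IsPairWalk

variable {Ω : Type} {mΩ : MeasurableSpace Ω} {P : Measure Ω} {ℱ : Filtration ℕ mΩ}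
  {X Y : ℕ → Ω → Fin d}

lemma ae_eventually_unifDist_le [IsFiniteMeasure P] (h : IsPairWalk δ α P ℱ X Y) (hd : 0 < d)
    (hδ : 0 < δ) (hα : 16 * (d : ℝ) ^ 3 < α) (m : ℕ) {r : ℝ} (hr : 0 < r) :
    ∀ᵐ ω ∂P, (∀ n ≥ m, 3 / 2 * δ ≤ ∑ i, occ d X n ω i * occ d Y n ω i) →
      ∃ N, ∀ n ≥ N, unifDist d (occ d X n ω) (occ d Y n ω) ≤ 2 * r := by
  obtain ⟨c, hc, hdecay⟩ := exists_le_decay hd hδ hα hr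
  have hae := h.ae_summable_of_potential hd m
    (Good := fun u v => 3 / 2 * δ ≤ ∑ i, u i * v i)
    (V := fun n u v => -(∑ i, u i * v i) - step d n)
    (D := fun n u v => step d (n + 1) / 2 * decay d δ α u v)
    (fun n _ u hu v hv => by
      linarith [(sum_mul_nonneg_le_one hu hv).1, step_pos hd n])
    (fun n _ u hu v hv hg => by
      have hγ := step_pos hd (n + 1)
      have hG := decay_nonneg hd hδ hα hu hv hg
      refine ⟨by positivity, decay_le_nextExp hd hδ hu hv hG hγ ?_ (step_succ_le hd n)
        (step_succ_sub hd n)⟩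
      exact_mod_cast step_le_inv (d := d) (m := 2) (n := n + 1) two_pos (by omega))
  filter_upwards [hae] with ω hω hgood
  have hx := fun n => occ_mem hd X n ω
  have hy := fun n => occ_mem hd Y n ω
  set w : ℕ → ℝ := fun n =>
    max (unifDist d (occ d X (n + m) ω) (occ d Y (n + m) ω) - r) 0 with hw
  have hw4 : ∀ n, w n ≤ 4 := fun n =>
    max_le (by linarith [unifDist_le_four hd (hx (n + m)) (hy (n + m))]) (by norm_num)
  have hwdecay : ∀ n, c / 4 * w n ≤ decay d δ α (occ d X (n + m) ω) (occ d Y (n + m) ω) := by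
    intro n
    have hg := hgood (n + m) (by omega)
    rcases le_total r (unifDist d (occ d X (n + m) ω) (occ d Y (n + m) ω)) with h1 | h1
    · have h2 := hdecay _ (hx (n + m)) _ (hy (n + m)) hg h1
      have h3 := mul_le_mul_of_nonneg_left (hw4 n) (by positivity : 0 ≤ c / 4)
      linarith
    · have : w n = 0 := max_eq_right (by linarith)
      rw [this, mul_zero]
      exact decay_nonneg hd hδ hα (hx _) (hy _) hg
  have hsum : Summable fun n => step d (n + (m + 1)) * w n := by
    refine Summable.of_nonneg_of_le
      (fun n => mul_nonneg (step_pos hd _).le (le_max_right _ _)) (fun n => ?_)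
      ((hω hgood).mul_left (8 / c))
    have h1 := mul_le_mul_of_nonneg_left (hwdecay n)
      (by have := step_pos hd (n + m + 1); positivity : 0 ≤ 8 / c * (step d (n + m + 1) / 2))
    have e : 8 / c * (step d (n + m + 1) / 2) * (c / 4 * w n) = step d (n + (m + 1)) * w n := by
      rw [← add_assoc]
      field_simp
      ring
    rw [e, mul_assoc] at h1
    exact h1
  have hslow : ∀ n, |w (n + 1) - w n| ≤ 4 * d * step d (n + (m + 1)) := by
    intro n
    have e : n + 1 + m = n + m + 1 := by omega
    have hγ1 : step d (n + m + 1) ≤ 1 := by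
      simpa using step_le_inv (d := d) (m := 1) (n := n + m + 1) one_pos (by omega)
    have h1 := abs_unifDist_move_sub_le hd (hx (n + m)) (hy (n + m))
      (step_pos hd (n + m + 1)).le hγ1 (X (n + m + 1) ω) (Y (n + m + 1) ω)
    rw [← occ_succ hd, ← occ_succ hd] at h1
    simp only [hw, e]
    refine (abs_max_sub_max_le_abs _ _ _).trans ?_
    rwa [sub_sub_sub_cancel_right]
  have hlim := tendsto_zero_of_slow (fun n => (step_pos hd _).le) (not_summable_step d (m + 1))
    (summable_step_sq d (m + 1)) (fun n => le_max_right _ _) hslow hsum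
  obtain ⟨N, hN⟩ := eventually_atTop.1 (hlim.eventually (gt_mem_nhds hr))
  refine ⟨N + m, fun n hn => ?_⟩
  obtain ⟨k, rfl⟩ := Nat.exists_eq_add_of_le' (show m ≤ n by omega)
  have := (le_max_left _ _).trans_lt (hN k (by omega))
  linarith

/-- The uniform configuration repels the walk. -/
lemma ae_not_forall_unifDist_le [IsFiniteMeasure P] (h : IsPairWalk δ α P ℱ X Y) (hd : 0 < d)
    (hδ : 0 < δ) {r : ℝ}
    (hr : ∀ u ∈ stdSimplex ℝ (Fin d), ∀ v ∈ stdSimplex ℝ (Fin d), unifDist d u v ≤ r →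
      600 * ∑ i, (u i - v i) ^ 2
          ≤ ∑ i, (piv d δ α v i - piv d δ α u i) * (u i - v i) ∧
        ∑ i, piv d δ α v i * piv d δ α u i ≤ 1 / 2) (m : ℕ) :
    ∀ᵐ ω ∂P, ¬ ∀ n ≥ m, unifDist d (occ d X n ω) (occ d Y n ω) ≤ r := by
  have hae := h.ae_summable_of_potential hd (m + 2000)
    (Good := fun u v => unifDist d u v ≤ r)
    (V := fun n u v => Real.log ((∑ k, (u k - v k) ^ 2) + step d n / 4) - 2)
    (D := fun n _ _ => step d (n + 1) / 2)
    (fun n _ u hu v hv => by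
      have h1 : step d n ≤ 1 := by
        simpa using step_le_inv (d := d) (m := 1) (n := n) one_pos (by omega)
      have h2 := step_pos hd n
      have h3 : 0 ≤ ∑ k, (u k - v k) ^ 2 := Finset.sum_nonneg fun _ _ => sq_nonneg _
      have h4 := Real.log_le_sub_one_of_pos
        (show 0 < (∑ k, (u k - v k) ^ 2) + step d n / 4 by linarith)
      linarith [sqDist_le_two hu hv])
    (fun n hn u hu v hv hg => by
      have hγ := step_pos hd (n + 1)
      obtain ⟨h1, h2⟩ := hr u hu v hv hg
      have h3 : step d (n + 1) ≤ 1 / 2000 := by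
        exact_mod_cast step_le_inv (d := d) (m := 2000) (n := n + 1) (by norm_num) (by omega)
      have h4 := log_add_le_nextExp hd hδ hu hv h1 h2 hγ h3 (step_succ_le hd n)
        (step_le_two_mul hd n) (step_succ_sub hd n)
      refine ⟨by positivity, ?_⟩
      rw [nextExp_sub_const hd hδ]
      linarith)
  filter_upwards [hae] with ω hω hgood
  refine not_summable_step d (m + 2000 + 1) ?_
  refine ((hω fun n hn => hgood n (by omega)).mul_left 2).congr fun n => ?_
  rw [mul_div_cancel₀ _ two_ne_zero]
  rfl

lemma ae_forall_exists_overlap_lt [IsFiniteMeasure P] (h : IsPairWalk δ α P ℱ X Y) (hd : 2 < d)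
    (hδ : 0 < δ) (hα : 16 * (d : ℝ) ^ 3 < α) (hα' : 601 ≤ α) :
    ∀ᵐ ω ∂P, ∀ m, ∃ n ≥ m, ∑ i, occ d X n ω i * occ d Y n ω i < 3 / 2 * δ := by
  have hd0 : 0 < d := by omega
  rcases lt_or_ge (1 / (d : ℝ)) (3 / 2 * δ) with hδd | hδd
  · refine ae_all_iff.2 fun m => ?_
    filter_upwards [h.ae_eventually_unifDist_le hd0 hδ hα m
      (r := (3 / 2 * δ - 1 / d) / 2) (by linarith)] with ω hω
    by_contra! hcon
    obtain ⟨N, hN⟩ := hω hcon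
    have h1 := hN (max N m) (le_max_left _ _)
    have h2 := hcon (max N m) (le_max_right _ _)
    have h3 := (abs_le.1 (abs_overlap_sub_le hd0 (occ_mem hd0 X (max N m) ω).2
      (occ_mem hd0 Y (max N m) ω).2)).2
    linarith
  · obtain ⟨r, hr, hloc⟩ := exists_local_monotone (α := α) hd hδ (by linarith)
    have hrep := ae_all_iff.2 (h.ae_not_forall_unifDist_le hd0 hδ (r := r)
      fun u hu v hv huv => ⟨le_trans (mul_le_mul_of_nonneg_right (by linarith)
        (Finset.sum_nonneg fun _ _ => sq_nonneg _)) (hloc u hu v hv huv).1,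
        (hloc u hu v hv huv).2⟩)
    refine ae_all_iff.2 fun m => ?_
    filter_upwards [hrep, h.ae_eventually_unifDist_le hd0 hδ hα m (half_pos hr)] with ω h1 h2
    by_contra! hcon
    obtain ⟨N, hN⟩ := h2 hcon
    exact h1 N fun n hn => (hN n hn).trans (by linarith)

lemma ae_eventually_overlap_lt [IsProbabilityMeasure P] (h : IsPairWalk δ α P ℱ X Y)
    (hd : 2 < d) (hδ : 0 < δ) (hα : 16 * (d : ℝ) ^ 3 < α) (hα' : 601 ≤ α) :
    ∀ᵐ ω ∂P, ∃ N, ∀ n ≥ N, ∑ i, occ d X n ω i * occ d Y n ω i < 2 * δ := by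
  have hd0 : 0 < d := by omega
  set V : ℕ → (Fin d → ℝ) → (Fin d → ℝ) → ℝ := fun n u v =>
    -((max ((∑ k, u k * v k) - 3 / 2 * δ) 0) ^ 2 + 11 * step d n) with hV
  set f : ℕ → Ω → ℝ := fun n ω => V n (occ d X n ω) (occ d Y n ω) with hf
  have hff : ∀ n, (f n).FactorsThrough (hist X Y n) := fun n ω ω' hω => by
    obtain ⟨h1, h2⟩ := occ_eq_of_hist_eq hω le_rfl
    simp only [hf, h1, h2]
  have hsub : Submartingale f ℱ P := by
    refine submartingale_nat (fun n => h.stronglyMeasurable (hff n))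
      (fun n => h.integrable (hff n)) fun n => ?_
    filter_upwards [h.condExp_next hd0 n (V (n + 1))] with ω hω
    refine le_of_le_of_eq ?_ hω.symm
    refine nextExp_excess_le hd0 hδ hα (occ_mem hd0 X n ω) (occ_mem hd0 Y n ω)
      (step_pos hd0 (n + 1)) ?_ (step_succ_le hd0 n) (step_succ_sub hd0 n)
    exact_mod_cast step_le_inv (d := d) (m := 2) (n := n + 1) two_pos (by omega)
  have hbdd : ∀ n, eLpNorm (f n) 1 P ≤ (12 : NNReal) := by
    intro n
    have h1 : ∀ ω, ‖f n ω‖ ≤ 12 := by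
      intro ω
      have h2 := (sum_mul_nonneg_le_one (occ_mem hd0 X n ω) (occ_mem hd0 Y n ω)).2
      have h3 : step d n ≤ 1 := by
        simpa using step_le_inv (d := d) (m := 1) (n := n) one_pos (by omega)
      have h4 := step_pos hd0 n
      have h5 : (max ((∑ k, occ d X n ω k * occ d Y n ω k) - 3 / 2 * δ) 0) ^ 2 ≤ 1 :=
        pow_le_one₀ (le_max_right _ _) (max_le (by linarith) zero_le_one)
      simp only [hf, hV]
      rw [norm_neg, Real.norm_of_nonneg (by positivity)]
      linarith
    refine (eLpNorm_le_of_ae_bound (ae_of_all _ h1)).trans ?_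
    simp
  filter_upwards [hsub.exists_ae_tendsto_of_bdd hbdd,
    h.ae_forall_exists_overlap_lt hd hδ hα hα'] with ω ⟨c, hc⟩ hio
  set M : ℕ → ℝ := fun n =>
    (max ((∑ k, occ d X n ω k * occ d Y n ω k) - 3 / 2 * δ) 0) ^ 2 with hM
  have hMlim : Tendsto M atTop (nhds (-c)) := by
    have h1 := hc.neg.sub ((tendsto_step d).const_mul 11)
    rw [mul_zero, sub_zero] at h1
    refine h1.congr fun n => ?_
    simp only [hf, hV, hM]
    ring
  have hc0 : -c = 0 := by
    by_contra hne
    obtain ⟨N, hN⟩ := eventually_atTop.1 (hMlim.eventually_ne hne)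
    obtain ⟨n, hn, hlt⟩ := hio N
    refine hN n hn ?_
    simp only [hM]
    rw [max_eq_right (by linarith)]
    norm_num
  rw [hc0] at hMlim
  obtain ⟨N, hN⟩ := eventually_atTop.1
    (hMlim.eventually (gt_mem_nhds (show (0 : ℝ) < (δ / 2) ^ 2 by positivity)))
  refine ⟨N, fun n hn => ?_⟩
  have h1 := lt_of_pow_lt_pow_left₀ 2 (by positivity) (hN n hn)
  have := (le_max_left _ _).trans_lt h1
  linarith

end IsPairWalk

end Convergence

/-- Theorem 1: for every `d ≥ 3` there is `α₀ > 0` such that for every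
`α > α₀` and `δ > 0`, for the two-particle vertex-reinforced interacting random walk on
the complete graph with `d` vertices, almost surely eventually
`∑ x_i(n) y_i(n) < 2 d^{1/(α+1)} δ`, i.e. `z(n)` eventually remains in `S^δ`. -/
theorem stmt_0 (d : ℕ) (hd : 3 ≤ d) :
    ∃ α₀ : ℝ, 0 < α₀ ∧
      ∀ α : ℝ, α₀ < α → ∀ δ : ℝ, 0 < δ →
      ∀ (Ω : Type) (mΩ : MeasurableSpace Ω) (P : Measure Ω),
        IsProbabilityMeasure P →
        ∀ (ℱ : Filtration ℕ mΩ) (X Y : ℕ → Ω → Fin d),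
          (∀ n, Measurable[ℱ n] (X n)) →
          (∀ n, Measurable[ℱ n] (Y n)) →
          (∀ (n : ℕ) (i j : Fin d),
            (P[(fun ω => (if X (n + 1) ω = i then (1 : ℝ) else 0) *
                  (if Y (n + 1) ω = j then (1 : ℝ) else 0)) | ℱ n]) =ᵐ[P]
              fun ω => piv d δ α (occ d Y n ω) i * piv d δ α (occ d X n ω) j) →
          ∀ᵐ ω ∂P, ∃ N : ℕ, ∀ n ≥ N,
            ∑ i, occ d X n ω i * occ d Y n ω i <
              2 * (d : ℝ) ^ ((1 : ℝ) / (α + 1)) * δ := by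
  refine ⟨700 + 16 * (d : ℝ) ^ 3, by positivity, ?_⟩
  intro α hα δ hδ Ω mΩ P hP ℱ X Y hX hY hlaw
  have hd3 : (0 : ℝ) ≤ 16 * (d : ℝ) ^ 3 := by positivity
  have hwalk : IsPairWalk δ α P ℱ X Y := ⟨hX, hY, hlaw⟩
  have hd1 : (1 : ℝ) ≤ d := by exact_mod_cast (by omega : 1 ≤ d)
  have hroot : 1 ≤ (d : ℝ) ^ ((1 : ℝ) / (α + 1)) :=
    Real.one_le_rpow hd1 (div_nonneg zero_le_one (by linarith))
  filter_upwards [hwalk.ae_eventually_overlap_lt (by omega) hδ (by linarith) (by linarith)]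
    with ω ⟨N, hN⟩
  refine ⟨N, fun n hn => (hN n hn).trans_le ?_⟩
  exact mul_le_mul_of_nonneg_right (by linarith) hδ.le
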